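/- arXiv:2511.19012 — 13 statements merged into one kernel-verified Lean document; each statement's English description precedes it below -/
import Mathlib

section
/- Let G be a multiplicative Lie algebra. Then the M-Frattini subalgebra Φ̃(G) is exactly the set of all non-generators of G. -/
/-- A multiplicative Lie algebra: a group `G` with a binary operation `⋆`
satisfying the five defining identities (where `ᵍh = g*h*g⁻¹`). -/
class MulLieAlgebra (G : Type*) extends Group G where
  star : G → G → G
  star_self : ∀ g : G, star g g = 1
  star_mul_right : ∀ g h k : G, star g (h * k) = star g h * (h * star g k * h⁻¹)
  star_mul_left : ∀ g h k : G, star (g * h) k = (g * star h k * g⁻¹) * star g k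
  star_jacobi : ∀ g h k : G,
    star (star g h) (h * k * h⁻¹) * star (star h k) (k * g * k⁻¹) *
      star (star k g) (g * h * g⁻¹) = 1
  conj_star : ∀ g h k : G, k * star g h * k⁻¹ = star (k * g * k⁻¹) (k * h * k⁻¹)

namespace MulLieAlgebra

local infixl:72 " ⋆ " => MulLieAlgebra.star

variable {G : Type*} [MulLieAlgebra G]

/-- A subalgebra: a subgroup closed under the Lie product. -/
def IsSubalgebra (H : Subgroup G) : Prop :=
  ∀ x ∈ H, ∀ y ∈ H, (x ⋆ y) ∈ H

/-- An ideal: a normal subgroup `H` with `g ⋆ h ∈ H` for all `g ∈ G`, `h ∈ H`. -/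
def IsIdeal (H : Subgroup G) : Prop :=
  H.Normal ∧ ∀ g : G, ∀ h ∈ H, (g ⋆ h) ∈ H

/-- The subalgebra generated by a subset `X`. -/
def subalgebraClosure (X : Set G) : Subgroup G :=
  sInf {H : Subgroup G | IsSubalgebra H ∧ X ⊆ (H : Set G)}

/-- A maximal (proper) subalgebra. -/
def IsMaximalSubalgebra (M : Subgroup G) : Prop :=
  IsSubalgebra M ∧ M ≠ ⊤ ∧ ∀ N : Subgroup G, IsSubalgebra N → M < N → N = ⊤

/-- The M-Frattini subalgebra `Φ̃(G)`: the intersection of all maximal subalgebras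
(`sInf ∅ = ⊤`, so it equals `G` when there is no maximal subalgebra). -/
def frattini (G : Type*) [MulLieAlgebra G] : Subgroup G :=
  sInf {M : Subgroup G | IsMaximalSubalgebra M}

end MulLieAlgebra

namespace MulLieAlgebra

local infixl:72 " ⋆ " => MulLieAlgebra.star

/-- A non-generator of `G`: an element that can be removed from any
generating set of the whole algebra. -/
def IsNonGenerator {G : Type*} [MulLieAlgebra G] (g : G) : Prop :=
  ∀ X : Set G, subalgebraClosure X = ⊤ → subalgebraClosure (X \ {g}) = ⊤

theorem closure_isSubalgebra {G : Type*} [MulLieAlgebra G] (X : Set G) :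
    IsSubalgebra (subalgebraClosure X) := by
  intro x hx y hy
  simp only [subalgebraClosure, Subgroup.mem_sInf] at hx hy ⊢
  exact fun H hH => hH.1 x (hx H hH) y (hy H hH)

theorem subset_subalgebraClosure {G : Type*} [MulLieAlgebra G] (X : Set G) :
    X ⊆ (subalgebraClosure X : Set G) := by
  intro x hx
  simp only [subalgebraClosure, SetLike.mem_coe, Subgroup.mem_sInf]
  exact fun H hH => hH.2 hx

theorem subalgebraClosure_le {G : Type*} [MulLieAlgebra G] {X : Set G} {H : Subgroup G}
    (h1 : IsSubalgebra H) (h2 : X ⊆ (H : Set G)) : subalgebraClosure X ≤ H :=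
  sInf_le ⟨h1, h2⟩

/-- the M-Frattini subalgebra of a multiplicative Lie algebra `G`
is exactly the set of all non-generators of `G`. -/
theorem frattini_eq_nonGenerators (G : Type*) [MulLieAlgebra G] :
    ∀ g : G, g ∈ frattini G ↔ IsNonGenerator g := by
  intro g
  constructor
  · intro hg X hX
    by_contra hne
    have hgK : g ∉ subalgebraClosure (X \ {g}) := by
      intro hgK
      apply hne
      rw [eq_top_iff, ← hX]
      apply subalgebraClosure_le (closure_isSubalgebra _)
      intro x hx
      by_cases hxg : x = g
      · rw [hxg]; exact hgK
      · exact subset_subalgebraClosure _ ⟨hx, hxg⟩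
    obtain ⟨M, hKM, hM⟩ := zorn_le_nonempty₀
      {H : Subgroup G | IsSubalgebra H ∧ g ∉ H} (by
        intro c hc hchain H hH
        have hmem : ∀ {x : G}, x ∈ sSup c ↔ ∃ s ∈ c, x ∈ s :=
          Subgroup.mem_sSup_of_directedOn ⟨H, hH⟩ hchain.directedOn
        refine ⟨sSup c, ⟨?_, ?_⟩, fun z hz => le_sSup hz⟩
        · intro x hx y hy
          obtain ⟨s, hs, hxs⟩ := hmem.1 hx
          obtain ⟨t, ht, hyt⟩ := hmem.1 hy
          rcases hchain.total hs ht with h | h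
          · exact hmem.2 ⟨t, ht, (hc ht).1 x (h hxs) y hyt⟩
          · exact hmem.2 ⟨s, hs, (hc hs).1 x hxs y (h hyt)⟩
        · intro hgs
          obtain ⟨s, hs, hgs⟩ := hmem.1 hgs
          exact (hc hs).2 hgs)
      (subalgebraClosure (X \ {g})) ⟨closure_isSubalgebra _, hgK⟩
    have hgM : g ∉ M := hM.prop.2
    apply hgM
    refine Subgroup.mem_sInf.1 hg M ⟨hM.prop.1, ?_, ?_⟩
    · rintro rfl
      exact hgM trivial
    · intro N hN hMN
      have hgN : g ∈ N := by
        by_contra hgN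
        exact hMN.not_ge (hM.le_of_ge ⟨hN, hgN⟩ hMN.le)
      rw [eq_top_iff, ← hX]
      apply subalgebraClosure_le hN
      intro x hx
      by_cases hxg : x = g
      · rw [hxg]; exact hgN
      · exact hMN.le (hKM (subset_subalgebraClosure _ ⟨hx, hxg⟩))
  · intro hg
    refine Subgroup.mem_sInf.2 fun M hM => ?_
    by_contra hgM
    have hsub := subset_subalgebraClosure (insert g (M : Set G))
    have htop : subalgebraClosure (insert g (M : Set G)) = ⊤ := by
      apply hM.2.2 _ (closure_isSubalgebra _)
      refine lt_of_le_of_ne (fun x hx => hsub (Or.inr hx)) ?_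
      intro h
      apply hgM
      rw [h]
      exact hsub (Or.inl rfl)
    apply hM.2.1
    rw [eq_top_iff, ← hg _ htop]
    apply subalgebraClosure_le hM.1
    rintro x ⟨hx | hx, hxg⟩
    · exact absurd hx hxg
    · exact hx

end MulLieAlgebra
end

section
/- Let H be a subalgebra of a multiplicative Lie algebra G. Then the multiplicative normalizer N_G(H) is a subalgebra of G. -/
namespace MulLieAlgebra

local infixl:72 " ⋆ " => MulLieAlgebra.star

variable {G : Type*} [MulLieAlgebra G]

end MulLieAlgebra

namespace MulLieAlgebra

local infixl:72 " ⋆ " => MulLieAlgebra.star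

variable {G : Type*} [MulLieAlgebra G]

/-- The multiplicative normalizer of a subset `S` of `G`:
`{g : gSg⁻¹ = S and g ⋆ s ∈ S for all s ∈ S}`. -/
def mulNormalizerSet (S : Set G) : Set G :=
  {g : G | (fun s => g * s * g⁻¹) '' S = S ∧ ∀ s ∈ S, (g ⋆ s) ∈ S}

end MulLieAlgebra

namespace MulLieAlgebra

theorem aux_one_left {G : Type*} [MulLieAlgebra G] (k : G) : star 1 k = 1 := by
  have h := star_mul_left 1 1 k
  simpa using h

theorem aux_one_right {G : Type*} [MulLieAlgebra G] (k : G) : star k 1 = 1 := by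
  have h := star_mul_right k 1 1
  simpa using h

theorem aux_antisymm {G : Type*} [MulLieAlgebra G] (g h : G) :
    star h g = (star g h)⁻¹ := by
  have e := star_self (g * h)
  rw [star_mul_left, star_mul_right, star_mul_right, star_self, star_self] at e
  have e2 : g * (star h g * star g h) * g⁻¹ = 1 := by
    rw [← e]; group
  have e3 : star h g * star g h = 1 := by
    have := congrArg (fun z => g⁻¹ * z * g) e2
    simpa [mul_assoc] using this
  exact eq_inv_of_mul_eq_one_left e3

theorem aux_expand {G : Type*} [MulLieAlgebra G] (g h k l : G) :
    star g k * (k * g * star h l * (k * g)⁻¹) =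
      g * k * star h l * (g * k)⁻¹ * star g k := by
  have e1 := star_mul_right (g * h) k l
  rw [star_mul_left g h (k * l), star_mul_left g h k, star_mul_left g h l,
    star_mul_right h k l, star_mul_right g k l] at e1
  have e2 := congrArg
    (fun z => (g * star h k * g⁻¹)⁻¹ * z * (k * star g l * k⁻¹)⁻¹) e1
  calc _ = _ := ?_
    _ = _ := e2.symm
    _ = _ := ?_
  · group
  · group

/-- `g ⋆ k` acts on Lie products as the commutator `[g, k]`. -/
theorem aux_act {G : Type*} [MulLieAlgebra G] (g k a b : G) :
    g * k * g⁻¹ * k⁻¹ * star a b * (g * k * g⁻¹ * k⁻¹)⁻¹ =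
      star g k * star a b * (star g k)⁻¹ := by
  have e := aux_expand g ((k * g)⁻¹ * a * (k * g)⁻¹⁻¹) k ((k * g)⁻¹ * b * (k * g)⁻¹⁻¹)
  rw [← conj_star] at e
  rw [eq_mul_inv_iff_mul_eq]
  calc _ = _ := ?_
    _ = _ := e.symm
    _ = _ := ?_
  · group
  · group

theorem aux_comm {G : Type*} [MulLieAlgebra G] (g k h : G) :
    star g (k * h * k⁻¹ * h⁻¹) = g * star k h * g⁻¹ * (star k h)⁻¹ := by
  have e1 := star_mul_left k (k⁻¹ * g * k) h
  have e2 := star_mul_left g k h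
  have e3 : k * (k⁻¹ * g * k) = g * k := by group
  rw [e3, e2, conj_star (k⁻¹ * g * k) h k] at e1
  have e4 : k * (k⁻¹ * g * k) * k⁻¹ = g := by group
  have e5 : k * h * k⁻¹ = (k * h * k⁻¹ * h⁻¹) * h := by group
  rw [e4, e5, star_mul_right, aux_act] at e1
  have e6 := congrArg (fun z => z * (star g h)⁻¹ * (star k h)⁻¹) e1
  calc _ = _ := ?_
    _ = _ := e6.symm
    _ = _ := ?_
  · group
  · group

theorem aux_mem_iff {G : Type*} [MulLieAlgebra G] (H : Subgroup G) (g : G) :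
    g ∈ mulNormalizerSet (H : Set G) ↔
      (∀ h ∈ H, g * h * g⁻¹ ∈ H) ∧ (∀ h ∈ H, g⁻¹ * h * g ∈ H) ∧
        ∀ h ∈ H, star g h ∈ H := by
  constructor
  · rintro ⟨h1, h2⟩
    refine ⟨fun h hh => ?_, fun h hh => ?_, h2⟩
    · have : g * h * g⁻¹ ∈ (fun s => g * s * g⁻¹) '' (H : Set G) := ⟨h, hh, rfl⟩
      rw [h1] at this
      exact this
    · have : h ∈ (fun s => g * s * g⁻¹) '' (H : Set G) := by rw [h1]; exact hh
      obtain ⟨s, hs, rfl⟩ := this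
      have e : g⁻¹ * (g * s * g⁻¹) * g = s := by group
      simp only [e]
      exact hs
  · rintro ⟨h1, h2, h3⟩
    refine ⟨?_, h3⟩
    ext z
    constructor
    · rintro ⟨s, hs, rfl⟩
      exact h1 s hs
    · intro hz
      exact ⟨g⁻¹ * z * g, h2 z hz, by group⟩

/-- The multiplicative normalizer as a subgroup. -/
def mulNormalizerSubgroup {G : Type*} [MulLieAlgebra G] (H : Subgroup G) : Subgroup G where
  carrier := mulNormalizerSet (H : Set G)
  one_mem' := by
    rw [aux_mem_iff]
    refine ⟨fun h hh => by simpa using hh, fun h hh => by simpa using hh, fun h _ => ?_⟩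
    rw [aux_one_left]
    exact H.one_mem
  mul_mem' := by
    intro a b ha hb
    rw [aux_mem_iff] at ha hb ⊢
    obtain ⟨a1, a2, a3⟩ := ha
    obtain ⟨b1, b2, b3⟩ := hb
    refine ⟨fun h hh => ?_, fun h hh => ?_, fun h hh => ?_⟩
    · have := a1 _ (b1 h hh)
      simpa [mul_assoc] using this
    · have := b2 _ (a2 h hh)
      simpa [mul_assoc] using this
    · rw [star_mul_left]
      exact H.mul_mem (a1 _ (b3 h hh)) (a3 h hh)
  inv_mem' := by
    intro a ha
    rw [aux_mem_iff] at ha ⊢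
    obtain ⟨a1, a2, a3⟩ := ha
    refine ⟨fun h hh => by simpa using a2 h hh, fun h hh => by simpa using a1 h hh,
      fun h hh => ?_⟩
    have e := star_mul_left a⁻¹ a h
    rw [inv_mul_cancel, aux_one_left, inv_inv] at e
    rw [eq_inv_of_mul_eq_one_right e.symm]
    exact H.inv_mem (a2 _ (a3 h hh))

/-- the multiplicative normalizer of a subalgebra `H` of a
multiplicative Lie algebra `G` is again a subalgebra of `G`. -/
theorem mulNormalizer_isSubalgebra {G : Type*} [MulLieAlgebra G]
    (H : Subgroup G) (hH : IsSubalgebra H) :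
    ∃ N : Subgroup G, (N : Set G) = mulNormalizerSet (H : Set G) ∧ IsSubalgebra N := by
  refine ⟨mulNormalizerSubgroup H, rfl, ?_⟩
  have hmem : ∀ g, g ∈ mulNormalizerSubgroup H ↔
      (∀ h ∈ H, g * h * g⁻¹ ∈ H) ∧ (∀ h ∈ H, g⁻¹ * h * g ∈ H) ∧
        ∀ h ∈ H, star g h ∈ H := fun g => aux_mem_iff H g
  have hHN : H ≤ mulNormalizerSubgroup H := by
    intro g hg
    rw [hmem]
    exact ⟨fun h hh => H.mul_mem (H.mul_mem hg hh) (H.inv_mem hg),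
      fun h hh => H.mul_mem (H.mul_mem (H.inv_mem hg) hh) hg, fun h hh => hH g hg h hh⟩
  have hstar : ∀ h ∈ H, ∀ n ∈ mulNormalizerSubgroup H, star h n ∈ H := by
    intro h hh n hn
    rw [aux_antisymm n h]
    exact H.inv_mem (((hmem n).1 hn).2.2 h hh)
  have hconj : ∀ x ∈ mulNormalizerSubgroup H, ∀ y ∈ mulNormalizerSubgroup H,
      ∀ h ∈ H, star x y * h * (star x y)⁻¹ ∈ H := by
    intro x hx y hy h hh
    have hc : x * y * x⁻¹ * y⁻¹ ∈ mulNormalizerSubgroup H :=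
      mul_mem (mul_mem (mul_mem hx hy) (inv_mem hx)) (inv_mem hy)
    have h1 := hstar h hh _ hc
    rw [aux_comm] at h1
    have h2 := H.mul_mem (H.inv_mem h1) hh
    have e : (h * star x y * h⁻¹ * (star x y)⁻¹)⁻¹ * h =
        star x y * h * (star x y)⁻¹ := by group
    rwa [e] at h2
  intro x hx y hy
  rw [hmem]
  refine ⟨hconj x hx y hy, fun h hh => ?_, fun h hh => ?_⟩
  · have := hconj y hy x hx h hh
    rwa [aux_antisymm x y, inv_inv] at this
  · have hk : y⁻¹ * h * y ∈ H := ((hmem y).1 hy).2.1 h hh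
    have hj := star_jacobi x y (y⁻¹ * h * y)
    have e : y * (y⁻¹ * h * y) * y⁻¹ = h := by group
    rw [e, mul_assoc] at hj
    rw [eq_inv_of_mul_eq_one_left hj]
    have hkN := hHN hk
    refine H.inv_mem (H.mul_mem ?_ ?_)
    · exact hstar _ (((hmem y).1 hy).2.2 _ hk) _ (mul_mem (mul_mem hkN hx) (inv_mem hkN))
    · exact hstar _ (hstar _ hk x hx) _ (mul_mem (mul_mem hx hy) (inv_mem hx))

end MulLieAlgebra
end

section
/- Let G be a multiplicative Lie algebra that is nilpotent of class n, i.e. Z_n(G) = G for its upper central series. Then for every subalgebra H of G, the n-th iterated multiplicative normalizer satisfies N_G^n(H) = G, where N_G^0(H) = H and N_G^{k+1}(H) = N_G(N_G^k(H)). -/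
namespace MulLieAlgebra

local infixl:72 " ⋆ " => MulLieAlgebra.star

variable {G : Type*} [MulLieAlgebra G]

end MulLieAlgebra

namespace MulLieAlgebra

local infixl:72 " ⋆ " => MulLieAlgebra.star

variable {G : Type*} [MulLieAlgebra G]

end MulLieAlgebra

namespace MulLieAlgebra

local infixl:72 " ⋆ " => MulLieAlgebra.star

/-- The upper central series of a multiplicative Lie algebra:
`Z₀ = {1}`, `Z_{k+1} = {g : [g,x] ∈ Z_k and g ⋆ x ∈ Z_k for all x}`. -/
def upperCentral (G : Type*) [MulLieAlgebra G] : ℕ → Set G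
  | 0 => {(1 : G)}
  | n + 1 => {g : G | ∀ x : G,
      g * x * g⁻¹ * x⁻¹ ∈ upperCentral G n ∧ (g ⋆ x) ∈ upperCentral G n}

end MulLieAlgebra


namespace MulLieAlgebra

theorem one_star_aux {G : Type*} [MulLieAlgebra G] (k : G) : star (1 : G) k = 1 := by
  have h := star_mul_left (1 : G) 1 k
  simpa using h

theorem mem_mulNormalizerSet_iff_aux {G : Type*} [MulLieAlgebra G] (S : Set G) (g : G) :
    g ∈ mulNormalizerSet S ↔
      (∀ s, g * s * g⁻¹ ∈ S ↔ s ∈ S) ∧ ∀ s ∈ S, star g s ∈ S := by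
  have key : (fun s => g * s * g⁻¹) '' S = S ↔ ∀ s, g * s * g⁻¹ ∈ S ↔ s ∈ S := by
    constructor
    · intro h s
      constructor
      · intro hs
        rw [← h] at hs
        obtain ⟨t, ht, e⟩ := hs
        have : t = s := by simpa using e
        exact this ▸ ht
      · intro hs
        rw [← h]
        exact ⟨s, hs, rfl⟩
    · intro h
      ext s
      constructor
      · rintro ⟨t, ht, rfl⟩
        exact (h t).2 ht
      · intro hs
        refine ⟨g⁻¹ * s * g, (h _).1 ?_, ?_⟩
        · simpa [mul_assoc] using hs
        · simp [mul_assoc]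
  unfold mulNormalizerSet
  rw [Set.mem_setOf_eq, key]

/-- The multiplicative normalizer of a subgroup is a subgroup. -/
def mulNormalizerAux {G : Type*} [MulLieAlgebra G] (K : Subgroup G) : Subgroup G where
  carrier := mulNormalizerSet (K : Set G)
  one_mem' := by
    rw [mem_mulNormalizerSet_iff_aux]
    refine ⟨by simp, fun s _ => ?_⟩
    rw [one_star_aux]
    exact K.one_mem
  mul_mem' := by
    intro a b ha hb
    rw [mem_mulNormalizerSet_iff_aux] at *
    refine ⟨fun s => ?_, fun s hs => ?_⟩
    · rw [← hb.1 s, ← ha.1 (b * s * b⁻¹)]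
      simp [mul_assoc]
    · rw [star_mul_left]
      exact K.mul_mem ((ha.1 _).2 (hb.2 s hs)) (ha.2 s hs)
  inv_mem' := by
    intro a ha
    rw [mem_mulNormalizerSet_iff_aux] at *
    have hc : ∀ s, a⁻¹ * s * a⁻¹⁻¹ ∈ (K : Set G) ↔ s ∈ (K : Set G) := by
      intro s
      rw [← ha.1 (a⁻¹ * s * a⁻¹⁻¹)]
      simp [mul_assoc]
    refine ⟨hc, fun s hs => ?_⟩
    have h := star_mul_left a⁻¹ a s
    rw [inv_mul_cancel, one_star_aux] at h
    rw [eq_inv_of_mul_eq_one_right h.symm]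
    exact K.inv_mem ((hc _).2 (ha.2 s hs))

theorem upperCentral_subset_aux {G : Type*} [MulLieAlgebra G] (H : Subgroup G) (n : ℕ) :
    ∃ K : Subgroup G, (mulNormalizerSet (G := G))^[n] (H : Set G) = (K : Set G) ∧
      upperCentral G n ⊆ (K : Set G) := by
  induction n with
  | zero =>
    refine ⟨H, rfl, ?_⟩
    intro g hg
    have : g = 1 := hg
    subst this
    exact H.one_mem
  | succ n ih =>
    obtain ⟨K, hK, hZ⟩ := ih
    refine ⟨mulNormalizerAux K, ?_, ?_⟩
    · rw [Function.iterate_succ_apply', hK]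
      rfl
    · intro g hg
      change g ∈ mulNormalizerSet (K : Set G)
      rw [mem_mulNormalizerSet_iff_aux]
      have hg' : ∀ x : G, g * x * g⁻¹ * x⁻¹ ∈ upperCentral G n ∧
        star g x ∈ upperCentral G n := hg
      refine ⟨fun s => ?_, fun s _ => hZ (hg' s).2⟩
      have h1 : g * s * g⁻¹ * s⁻¹ ∈ K := hZ (hg' s).1
      constructor
      · intro h
        exact K.inv_mem_iff.1 ((K.mul_mem_cancel_left h).1 h1)
      · intro h
        exact (K.mul_mem_cancel_right (K.inv_mem h)).1 h1

/-- if `G` is a multiplicative Lie algebra that is nilpotent of class `n`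
(`Z_n(G) = G`), then for every subalgebra `H` the `n`-th iterated multiplicative
normalizer of `H` is all of `G`. -/
theorem iterated_mulNormalizer_eq_top {G : Type*} [MulLieAlgebra G] (n : ℕ)
    (hnil : upperCentral G n = Set.univ)
    (H : Subgroup G) (hH : IsSubalgebra H) :
    (mulNormalizerSet (G := G))^[n] (H : Set G) = Set.univ := by
  obtain ⟨K, hK, hZ⟩ := upperCentral_subset_aux H n
  rw [hnil] at hZ
  rw [hK]
  exact Set.univ_subset_iff.1 hZ

end MulLieAlgebra
end

section
/- Every nilpotent multiplicative Lie algebra G satisfies the multiplicative normalizer condition: every proper subalgebra H of G is properly contained in its multiplicative normalizer, i.e. H ⊊ N_G(H). -/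
namespace MulLieAlgebra

local infixl:72 " ⋆ " => MulLieAlgebra.star

variable {G : Type*} [MulLieAlgebra G]

end MulLieAlgebra

namespace MulLieAlgebra

local infixl:72 " ⋆ " => MulLieAlgebra.star

variable {G : Type*} [MulLieAlgebra G]

end MulLieAlgebra

namespace MulLieAlgebra

local infixl:72 " ⋆ " => MulLieAlgebra.star

end MulLieAlgebra

namespace MulLieAlgebra

/-- every nilpotent multiplicative Lie algebra satisfies the
multiplicative normalizer condition: every proper subalgebra is properly
contained in its multiplicative normalizer. -/
theorem normalizer_condition_of_nilpotent {G : Type*} [MulLieAlgebra G]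
    (hnil : ∃ n : ℕ, upperCentral G n = Set.univ)
    (H : Subgroup G) (hH : IsSubalgebra H) (hne : H ≠ ⊤) :
    (H : Set G) ⊂ mulNormalizerSet (H : Set G) := by
  classical
  have hex : ∃ n : ℕ, ¬ upperCentral G n ⊆ (H : Set G) := by
    obtain ⟨n, hn⟩ := hnil
    refine ⟨n, fun hs => hne ?_⟩
    rw [hn] at hs
    exact (Subgroup.eq_top_iff' H).2 fun x => hs (Set.mem_univ x)
  obtain ⟨m, hm, g, hg, hgH⟩ : ∃ m : ℕ, upperCentral G m ⊆ (H : Set G) ∧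
      ∃ g ∈ upperCentral G (m + 1), g ∉ H := by
    have hspec := Nat.find_spec hex
    have hmin := fun k => Nat.find_min hex (m := k)
    generalize Nat.find hex = n at hspec hmin
    cases n with
    | zero =>
      refine absurd ?_ hspec
      intro x hx
      have hx1 : x = 1 := hx
      rw [hx1]
      exact H.one_mem
    | succ m =>
      refine ⟨m, not_not.1 (hmin m (Nat.lt_succ_self m)), ?_⟩
      obtain ⟨g, h1, h2⟩ := Set.not_subset.1 hspec
      exact ⟨g, h1, h2⟩
  have hg' : ∀ x : G, g * x * g⁻¹ * x⁻¹ ∈ upperCentral G m ∧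
      star g x ∈ upperCentral G m := hg
  -- conjugation by an element preserving `H` in both directions fixes `H`
  have himg : ∀ a : G, (∀ h ∈ H, a * h * a⁻¹ ∈ H) → (∀ h ∈ H, a⁻¹ * h * a ∈ H) →
      (fun s => a * s * a⁻¹) '' (H : Set G) = H := by
    intro a h1 h2
    ext y
    constructor
    · rintro ⟨s, hs, rfl⟩
      exact h1 s hs
    · intro hy
      exact ⟨a⁻¹ * y * a, h2 y hy, by group⟩
  rw [Set.ssubset_iff_of_subset]
  · refine ⟨g, ⟨himg g ?_ ?_, fun s _ => hm (hg' s).2⟩, hgH⟩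
    · intro h hh
      have h1 : g * h * g⁻¹ * h⁻¹ ∈ H := hm (hg' h).1
      simpa using H.mul_mem h1 hh
    · intro h hh
      have h1 : g * (g⁻¹ * h * g) * g⁻¹ * (g⁻¹ * h * g)⁻¹ ∈ H := hm (hg' _).1
      have h2 := H.mul_mem (H.inv_mem h1) hh
      have h3 : (g * (g⁻¹ * h * g) * g⁻¹ * (g⁻¹ * h * g)⁻¹)⁻¹ * h = g⁻¹ * h * g := by group
      rwa [h3] at h2
  · intro a ha
    exact ⟨himg a (fun h hh => H.mul_mem (H.mul_mem ha hh) (H.inv_mem ha))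
      (fun h hh => H.mul_mem (H.mul_mem (H.inv_mem ha) hh) ha), fun s hs => hH a ha s hs⟩

end MulLieAlgebra
end

section
/- Let G be a nilpotent multiplicative Lie algebra. Then every maximal proper subalgebra of G is an ideal of G. -/
namespace MulLieAlgebra

local infixl:72 " ⋆ " => MulLieAlgebra.star

variable {G : Type*} [MulLieAlgebra G]

end MulLieAlgebra

namespace MulLieAlgebra

local infixl:72 " ⋆ " => MulLieAlgebra.star

end MulLieAlgebra

namespace MulLieAlgebra

section helpers

variable {G : Type*} [MulLieAlgebra G]

theorem aux_one_star (x : G) : star (1 : G) x = 1 := by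
  have h := star_mul_left (1 : G) 1 x
  simpa using h

theorem aux_star_swap (g h : G) : star g h = (star h g)⁻¹ := by
  have e := star_self (g * h)
  rw [star_mul_left, star_mul_right h g h, star_mul_right g g h, star_self, star_self] at e
  have e2 : g * (star h g * star g h) * g⁻¹ = 1 := by
    rw [← e]; group
  have e3 : star h g * star g h = 1 := by
    have := congrArg (fun t => g⁻¹ * t * g) e2
    simpa [mul_assoc] using this
  exact eq_inv_of_mul_eq_one_right e3

theorem aux_inv_star (g x : G) : star g⁻¹ x = g⁻¹ * (star g x)⁻¹ * g := by
  have e := star_mul_left g⁻¹ g x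
  rw [inv_mul_cancel, aux_one_star] at e
  rw [eq_comm, mul_eq_one_iff_inv_eq] at e
  rw [← e]; group

theorem aux_upper (n : ℕ) : ∃ K : Subgroup G, K.Normal ∧ (K : Set G) = upperCentral G n := by
  induction n with
  | zero => exact ⟨⊥, inferInstance, by simp [upperCentral]⟩
  | succ n ih =>
    obtain ⟨K, hK, e⟩ := ih
    have key : ∀ g : G, g ∈ upperCentral G (n + 1) ↔
        ∀ x : G, g * x * g⁻¹ * x⁻¹ ∈ K ∧ star g x ∈ K := by
      intro g
      simp only [upperCentral, ← e]
      rfl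
    refine ⟨{ carrier := upperCentral G (n + 1), one_mem' := ?_, mul_mem' := ?_, inv_mem' := ?_ },
      ⟨?_⟩, rfl⟩
    · intro a b ha hb
      rw [key] at ha hb ⊢
      intro x
      constructor
      · have := K.mul_mem (hK.conj_mem _ (hb x).1 a) (ha x).1
        convert this using 1
        group
      · rw [star_mul_left]
        exact K.mul_mem (hK.conj_mem _ (hb x).2 a) (ha x).2
    · rw [key]
      intro x
      simp [aux_one_star, K.one_mem]
    · intro a ha
      rw [key] at ha ⊢
      intro x
      constructor
      · have := hK.conj_mem _ (K.inv_mem (ha x).1) a⁻¹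
        convert this using 1
        group
      · rw [aux_inv_star]
        have := hK.conj_mem _ (K.inv_mem (ha x).2) a⁻¹
        simpa using this
    · intro a ha g
      change a ∈ upperCentral G (n + 1) at ha
      change g * a * g⁻¹ ∈ upperCentral G (n + 1)
      rw [key] at ha ⊢
      intro x
      constructor
      · have := hK.conj_mem _ (ha (g⁻¹ * x * g)).1 g
        convert this using 1
        group
      · have := hK.conj_mem _ (ha (g⁻¹ * x * g)).2 g
        rw [conj_star] at this
        convert this using 2
        group

theorem aux_mono (n : ℕ) : upperCentral G n ⊆ upperCentral G (n + 1) := by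
  induction n with
  | zero =>
    intro g hg x
    simp only [upperCentral, Set.mem_singleton_iff] at hg ⊢
    subst hg
    simp [aux_one_star]
  | succ n ih =>
    intro g hg x
    exact ⟨ih (hg x).1, ih (hg x).2⟩

end helpers

/-- in a nilpotent multiplicative Lie algebra, every maximal
(proper) subalgebra is an ideal. -/
theorem maximal_subalgebra_isIdeal_of_nilpotent {G : Type*} [MulLieAlgebra G]
    (hnil : ∃ n : ℕ, upperCentral G n = Set.univ)
    (M : Subgroup G) (hM : IsMaximalSubalgebra M) :
    IsIdeal M := by
  classical
  obtain ⟨hsub, hne, hmax⟩ := hM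
  have hex : ∃ n : ℕ, ¬ upperCentral G n ⊆ (M : Set G) := by
    obtain ⟨n, hn⟩ := hnil
    refine ⟨n, fun h => hne ?_⟩
    rw [hn] at h
    exact (Subgroup.eq_top_iff' M).2 fun x => h (Set.mem_univ x)
  obtain ⟨k, hk, hk1⟩ : ∃ k : ℕ, upperCentral G k ⊆ (M : Set G) ∧
      ¬ upperCentral G (k + 1) ⊆ (M : Set G) := by
    by_contra hcon
    push Not at hcon
    obtain ⟨n, hn⟩ := hex
    apply hn
    clear hn
    induction n with
    | zero =>
      intro g hg
      simp only [upperCentral, Set.mem_singleton_iff] at hg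
      subst hg
      exact M.one_mem
    | succ n ih => exact hcon n ih
  obtain ⟨Z, hZ, eZ⟩ := aux_upper (G := G) (k + 1)
  have memZ : ∀ z ∈ Z, ∀ x : G, z * x * z⁻¹ * x⁻¹ ∈ M ∧ star z x ∈ M ∧ star z x ∈ Z := by
    intro z hz x
    have hz' : z ∈ upperCentral G (k + 1) := by rw [← eZ]; exact hz
    refine ⟨hk (hz' x).1, hk (hz' x).2, ?_⟩
    have h3 := aux_mono k (hz' x).2
    rw [← eZ] at h3
    exact h3
  have hle : Z ≤ M ⊔ Z := le_sup_right
  have hleM : M ≤ M ⊔ Z := le_sup_left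
  have htop : M ⊔ Z = ⊤ := by
    apply hmax
    · intro x hx y hy
      obtain ⟨m, hm, z, hz, rfl⟩ := Subgroup.mem_sup_of_normal_right.1 hx
      obtain ⟨m', hm', z', hz', rfl⟩ := Subgroup.mem_sup_of_normal_right.1 hy
      rw [star_mul_left, star_mul_right m m' z', aux_star_swap m z']
      refine Subgroup.mul_mem _ (hle (hZ.conj_mem _ (memZ z hz _).2.2 m)) ?_
      exact Subgroup.mul_mem _ (hleM (hsub m hm m' hm'))
        (hle (hZ.conj_mem _ (Z.inv_mem (memZ z' hz' m).2.2) m'))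
    · refine lt_of_le_of_ne hleM fun h => hk1 ?_
      rw [← eZ]
      intro z hz
      rw [h]
      exact hle hz
  have hdec : ∀ g : G, ∃ m ∈ M, ∃ z ∈ Z, m * z = g := by
    intro g
    have hg : g ∈ M ⊔ Z := by rw [htop]; trivial
    exact Subgroup.mem_sup_of_normal_right.1 hg
  refine ⟨⟨?_⟩, ?_⟩
  · intro h hh g
    obtain ⟨m, hm, z, hz, rfl⟩ := hdec g
    have h1 := M.mul_mem (memZ z hz h).1 hh
    have h2 := M.mul_mem (M.mul_mem hm h1) (M.inv_mem hm)
    convert h2 using 1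
    group
  · intro g h hh
    obtain ⟨m, hm, z, hz, rfl⟩ := hdec g
    rw [star_mul_left]
    exact M.mul_mem (M.mul_mem (M.mul_mem hm (memZ z hz h).2.1) (M.inv_mem hm)) (hsub m hm h hh)

end MulLieAlgebra
end

section
/- Let G be a multiplicative Lie algebra. Then 𝒵(G) ∩ ^M[G,G] ⊆ Φ̃(G), i.e. the intersection of the multiplicative center with the multiplicative commutator is contained in the M-Frattini subalgebra. -/
namespace MulLieAlgebra

local infixl:72 " ⋆ " => MulLieAlgebra.star

variable {G : Type*} [MulLieAlgebra G]

end MulLieAlgebra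

namespace MulLieAlgebra

local infixl:72 " ⋆ " => MulLieAlgebra.star

/-- The multiplicative commutator `^M[G,G]`: the subgroup generated by all
group commutators and all Lie products. -/
def mulCommutator (G : Type*) [MulLieAlgebra G] : Subgroup G :=
  Subgroup.closure
    ({x : G | ∃ a b : G, x = a * b * a⁻¹ * b⁻¹} ∪ {x : G | ∃ a b : G, x = a ⋆ b})

end MulLieAlgebra

namespace MulLieAlgebra

local infixl:72 " ⋆ " => MulLieAlgebra.star

/-- The multiplicative center `𝒵(G) = {g : [g,x] = 1 and g ⋆ x = 1 for all x}`. -/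
def mulCenter (G : Type*) [MulLieAlgebra G] : Set G :=
  {g : G | ∀ x : G, g * x = x * g ∧ (g ⋆ x) = 1}

theorem one_star' {G : Type*} [MulLieAlgebra G] (x : G) : (1 : G) ⋆ x = 1 := by
  have h := star_mul_left (1 : G) 1 x
  simpa using h

theorem star_center {G : Type*} [MulLieAlgebra G] {z : G} (hz : z ∈ mulCenter G) (x : G) :
    x ⋆ z = 1 := by
  have h := star_self (x * z)
  rw [star_mul_left, (hz _).2, star_mul_right, star_self] at h
  simpa using h

/-- The multiplicative center as a subgroup. -/
def centerSubgroup (G : Type*) [MulLieAlgebra G] : Subgroup G where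
  carrier := mulCenter G
  one_mem' := fun x => ⟨by simp, one_star' x⟩
  mul_mem' := by
    intro a b ha hb x
    refine ⟨?_, ?_⟩
    · rw [mul_assoc, (hb x).1, ← mul_assoc, (ha x).1, mul_assoc]
    · rw [star_mul_left, (ha x).2, (hb x).2]; simp
  inv_mem' := by
    intro a ha x
    have hc : Commute a x := (ha x).1
    refine ⟨hc.inv_left, ?_⟩
    have h := star_mul_left a⁻¹ a x
    rw [inv_mul_cancel, one_star', (ha x).2] at h
    simpa using h.symm

/-- The product of a subgroup and the multiplicative center. -/
def mulCenterProd {G : Type*} [MulLieAlgebra G] (M : Subgroup G) : Subgroup G where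
  carrier := {x | ∃ m ∈ M, ∃ z ∈ centerSubgroup G, x = m * z}
  one_mem' := ⟨1, M.one_mem, 1, (centerSubgroup G).one_mem, by simp⟩
  mul_mem' := by
    rintro _ _ ⟨m, hm, z, hz, rfl⟩ ⟨n, hn, w, hw, rfl⟩
    refine ⟨m * n, M.mul_mem hm hn, z * w, (centerSubgroup G).mul_mem hz hw, ?_⟩
    have h : z * n = n * z := (hz n).1
    rw [mul_assoc, ← mul_assoc z, h]
    group
  inv_mem' := by
    rintro _ ⟨m, hm, z, hz, rfl⟩
    refine ⟨m⁻¹, M.inv_mem hm, z⁻¹, (centerSubgroup G).inv_mem hz, ?_⟩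
    rw [mul_inv_rev]
    exact (((centerSubgroup G).inv_mem hz) m⁻¹).1

theorem star_mul_center {G : Type*} [MulLieAlgebra G] {z w : G}
    (hz : z ∈ centerSubgroup G) (hw : w ∈ centerSubgroup G) (m n : G) :
    (m * z) ⋆ (n * w) = m ⋆ n := by
  rw [star_mul_left, (hz _).2, star_mul_right, star_center hw]
  simp

theorem comm_mul_center {G : Type*} [MulLieAlgebra G] {z w : G}
    (hz : z ∈ centerSubgroup G) (hw : w ∈ centerSubgroup G) (m n : G) :
    (m * z) * (n * w) * (m * z)⁻¹ * (n * w)⁻¹ = m * n * m⁻¹ * n⁻¹ := by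
  have h1 : z * (n * w) = n * w * z := (hz _).1
  have h2 : w * m⁻¹ = m⁻¹ * w := (hw _).1
  calc (m * z) * (n * w) * (m * z)⁻¹ * (n * w)⁻¹
      = m * (z * (n * w)) * z⁻¹ * m⁻¹ * w⁻¹ * n⁻¹ := by group
    _ = m * n * (w * m⁻¹) * w⁻¹ * n⁻¹ := by rw [h1]; group
    _ = m * n * m⁻¹ * n⁻¹ := by rw [h2]; group

/-- for any multiplicative Lie algebra `G`,
`𝒵(G) ∩ ^M[G,G] ⊆ Φ̃(G)`. -/
theorem mulCenter_inter_mulCommutator_le_frattini {G : Type*} [MulLieAlgebra G] :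
    ∀ g : G, g ∈ mulCenter G → g ∈ mulCommutator G → g ∈ frattini G := by
  intro g hg hc
  refine Subgroup.mem_sInf.2 ?_
  rintro M ⟨hsub, -, hmax⟩
  by_contra hgM
  have hN : mulCenterProd M = ⊤ := by
    apply hmax
    · rintro _ ⟨m, hm, z, hz, rfl⟩ _ ⟨n, hn, w, hw, rfl⟩
      rw [star_mul_center hz hw]
      exact ⟨m ⋆ n, hsub m hm n hn, 1, (centerSubgroup G).one_mem, by simp⟩
    · refine lt_of_le_of_ne ?_ ?_
      · intro m hm
        exact ⟨m, hm, 1, (centerSubgroup G).one_mem, by simp⟩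
      · intro h
        apply hgM
        rw [h]
        exact ⟨1, M.one_mem, g, hg, by simp⟩
  have hall : ∀ x : G, ∃ m ∈ M, ∃ z ∈ centerSubgroup G, x = m * z := by
    intro x
    have hx : x ∈ mulCenterProd M := by rw [hN]; trivial
    exact hx
  apply hgM
  refine (Subgroup.closure_le M).2 ?_ hc
  rintro _ (⟨a, b, rfl⟩ | ⟨a, b, rfl⟩)
  · obtain ⟨m, hm, z, hz, rfl⟩ := hall a
    obtain ⟨n, hn, w, hw, rfl⟩ := hall b
    rw [comm_mul_center hz hw]
    exact M.mul_mem (M.mul_mem (M.mul_mem hm hn) (M.inv_mem hm)) (M.inv_mem hn)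
  · obtain ⟨m, hm, z, hz, rfl⟩ := hall a
    obtain ⟨n, hn, w, hw, rfl⟩ := hall b
    rw [star_mul_center hz hw]
    exact hsub m hm n hn

end MulLieAlgebra
end

section
/- Let G be a finite multiplicative Lie algebra and K an ideal of G. Then K ⊆ Φ̃(G) if and only if there is no proper subalgebra H of G with HK = G, where HK = {hk : h ∈ H, k ∈ K}. -/
namespace MulLieAlgebra

local infixl:72 " ⋆ " => MulLieAlgebra.star

variable {G : Type*} [MulLieAlgebra G]

end MulLieAlgebra

namespace MulLieAlgebra

theorem star_swap {G : Type*} [MulLieAlgebra G] (g k : G) :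
    MulLieAlgebra.star k g = (MulLieAlgebra.star g k)⁻¹ := by
  have h := star_self (k * g)
  rw [star_mul_left, star_mul_right, star_mul_right, star_self, star_self] at h
  have h2 : k * (star g k * star k g) * k⁻¹ = 1 := by
    rw [← h]; group
  rw [conj_eq_one_iff] at h2
  exact eq_inv_of_mul_eq_one_right h2

theorem isSubalgebra_sup {G : Type*} [MulLieAlgebra G] (H K : Subgroup G)
    (hH : IsSubalgebra H) (hK : IsIdeal K) : IsSubalgebra (H ⊔ K) := by
  obtain ⟨hN, hI⟩ := hK
  have hI' : ∀ g : G, ∀ k ∈ K, star k g ∈ K := fun g k hk => by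
    rw [star_swap]; exact K.inv_mem (hI g k hk)
  intro x hx y hy
  rw [Subgroup.mem_sup_of_normal_right] at hx hy
  obtain ⟨h, hh, k, hk, rfl⟩ := hx
  obtain ⟨h', hh', k', hk', rfl⟩ := hy
  rw [star_mul_left, star_mul_right h]
  have hle : K ≤ H ⊔ K := le_sup_right
  exact mul_mem (hle (hN.conj_mem _ (hI' _ k hk) h))
    (mul_mem ((le_sup_left : H ≤ H ⊔ K) (hH h hh h' hh'))
      (hle (hN.conj_mem _ (hI h k' hk') h')))

/-- for a finite multiplicative Lie algebra `G` and an ideal `K`,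
`K ⊆ Φ̃(G)` iff there is no proper subalgebra `H` of `G` with `HK = G`. -/
theorem le_frattini_iff_no_proper_supplement {G : Type*} [MulLieAlgebra G] [Finite G]
    (K : Subgroup G) (hK : IsIdeal K) :
    K ≤ frattini G ↔
      ¬ ∃ H : Subgroup G, IsSubalgebra H ∧ H ≠ ⊤ ∧
        ∀ g : G, ∃ h ∈ H, ∃ k ∈ K, g = h * k := by
  constructor
  · rintro hle ⟨H, hH, hne, hsup⟩
    obtain ⟨M, hHM, hM⟩ := (Set.toFinite {N : Subgroup G | IsSubalgebra N ∧ N ≠ ⊤}).exists_le_maximal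
      (show H ∈ {N : Subgroup G | IsSubalgebra N ∧ N ≠ ⊤} from ⟨hH, hne⟩)
    have hmax : IsMaximalSubalgebra M := by
      refine ⟨hM.prop.1, hM.prop.2, fun N hN hlt => ?_⟩
      by_contra hNt
      exact hlt.not_ge (hM.le_of_ge ⟨hN, hNt⟩ hlt.le)
    have hKM : K ≤ M := hle.trans (sInf_le hmax)
    apply hM.prop.2
    rw [eq_top_iff]
    intro g _
    obtain ⟨h, hh, k, hk, rfl⟩ := hsup g
    exact mul_mem (hHM hh) (hKM hk)
  · intro hno
    refine le_sInf fun M hM => ?_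
    by_contra hKM
    apply hno
    refine ⟨M, hM.1, hM.2.1, fun g => ?_⟩
    have htop : M ⊔ K = ⊤ := hM.2.2 _ (isSubalgebra_sup M K hM.1 hK)
      (left_lt_sup.2 hKM)
    have hg : g ∈ M ⊔ K := htop ▸ Subgroup.mem_top g
    have := hK.1
    rw [Subgroup.mem_sup_of_normal_right] at hg
    obtain ⟨h, hh, k, hk, rfl⟩ := hg
    exact ⟨h, hh, k, hk, rfl⟩

end MulLieAlgebra
end

section
/- Let G be a finite multiplicative Lie algebra and K a nilpotent ideal of G. Then Φ̃(K) ⊆ Φ̃(G). -/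
namespace MulLieAlgebra

local infixl:72 " ⋆ " => MulLieAlgebra.star

variable {G : Type*} [MulLieAlgebra G]

end MulLieAlgebra

namespace MulLieAlgebra

variable {G : Type*} [MulLieAlgebra G]

/-- A maximal proper subalgebra of the subalgebra `H` (all inside `G`). -/
def IsMaximalSubalgebraIn (H M : Subgroup G) : Prop :=
  IsSubalgebra M ∧ M < H ∧ ∀ N : Subgroup G, IsSubalgebra N → N ≤ H → M < N → N = H

/-- The M-Frattini subalgebra `Φ̃(H)` of a subalgebra `H` of `G`: the
intersection of all maximal proper subalgebras of `H` (and `H` itself when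
`H` has no maximal subalgebra, since then `sInf ∅ = ⊤`). -/
def frattiniIn (H : Subgroup G) : Subgroup G :=
  H ⊓ sInf {M : Subgroup G | IsMaximalSubalgebraIn H M}

end MulLieAlgebra

namespace MulLieAlgebra

local infixl:72 " ⋆ " => MulLieAlgebra.star

/-- The upper central series of a subalgebra `K` of `G` (computed inside `K`):
`Z₀(K) = {1}`, `Z_{k+1}(K) = {g ∈ K : [g,x] ∈ Z_k(K) and g ⋆ x ∈ Z_k(K) for all x ∈ K}`. -/
def upperCentralIn {G : Type*} [MulLieAlgebra G] (K : Subgroup G) : ℕ → Set G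
  | 0 => {(1 : G)}
  | n + 1 => {g : G | g ∈ K ∧ ∀ x ∈ K,
      g * x * g⁻¹ * x⁻¹ ∈ upperCentralIn K n ∧ (g ⋆ x) ∈ upperCentralIn K n}

section helpers

variable {G : Type*} [MulLieAlgebra G]

lemma star_anti (g h : G) : h ⋆ g = (g ⋆ h)⁻¹ := by
  have h1 := star_self (g * h)
  rw [star_mul_left, star_mul_right, star_mul_right, star_self, star_self] at h1
  rw [eq_inv_iff_mul_eq_one]
  have h2 : g * (h ⋆ g * g ⋆ h) * g⁻¹ = 1 := by
    rw [← h1]; group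
  rwa [conj_eq_one_iff] at h2

/-- Auxiliary: a biderivation-like map on `M ⊔ ⟨z⟩`. -/
lemma aux_bider (f : G → G → G)
    (hmul : ∀ g h k, f (g * h) k = (g * f h k * g⁻¹) * f g k)
    (hanti : ∀ g h, f h g = (f g h)⁻¹)
    (M : Subgroup G) (z : G)
    (hnorm : M ⊔ Subgroup.zpowers z ≤ Subgroup.normalizer (M : Set G))
    (hz : ∀ x ∈ M ⊔ Subgroup.zpowers z, f z x ∈ M)
    (hM : ∀ x ∈ M, ∀ y ∈ M, f x y ∈ M) :
    ∀ x ∈ M ⊔ Subgroup.zpowers z, ∀ y ∈ M ⊔ Subgroup.zpowers z, f x y ∈ M := by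
  set T := M ⊔ Subgroup.zpowers z with hT
  have hc : ∀ t ∈ T, ∀ m ∈ M, t * m * t⁻¹ ∈ M := fun t ht m hm =>
    ((Subgroup.mem_normalizer_iff.1 (hnorm ht)) m).1 hm
  have hone : ∀ k, f 1 k = 1 := fun k => by
    have := hmul 1 1 k
    simpa using this
  let S : G → Subgroup G := fun y =>
    { carrier := {x | x ∈ T ∧ f x y ∈ M}
      one_mem' := ⟨T.one_mem, by rw [hone]; exact M.one_mem⟩
      mul_mem' := by
        rintro a b ⟨ha, ha'⟩ ⟨hb, hb'⟩
        refine ⟨T.mul_mem ha hb, ?_⟩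
        rw [hmul]
        exact M.mul_mem (hc a ha _ hb') ha'
      inv_mem' := by
        rintro a ⟨ha, ha'⟩
        refine ⟨T.inv_mem ha, ?_⟩
        have h1 := hmul a⁻¹ a y
        rw [inv_mul_cancel, hone] at h1
        rw [← inv_eq_of_mul_eq_one_right h1.symm]
        exact M.inv_mem (hc _ (T.inv_mem ha) _ ha') }
  have hMT : M ≤ T := le_sup_left
  have hzT : z ∈ T := (le_sup_right : _ ≤ T) (Subgroup.mem_zpowers z)
  have key : ∀ y ∈ T, (∀ x ∈ M, f x y ∈ M) → ∀ x ∈ T, f x y ∈ M := by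
    intro y hy h x hx
    have : T ≤ S y := by
      rw [hT]
      refine sup_le (fun m hm => ⟨hMT hm, h m hm⟩) ?_
      rw [Subgroup.zpowers_le]
      exact ⟨hzT, hz y hy⟩
    exact (this hx).2
  have k1 : ∀ y ∈ M, ∀ x ∈ T, f x y ∈ M := fun y hy =>
    key y (hMT hy) (fun x hx => hM x hx y hy)
  intro x hx y hy
  refine key y hy (fun m hm => ?_) x hx
  rw [hanti y m]
  exact M.inv_mem (k1 m hm y hy)

/-- Subgroup contains all commutators and products of `K`. -/
def ContainsDerived (K M : Subgroup G) : Prop :=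
  ∀ x ∈ K, ∀ y ∈ K, x * y * x⁻¹ * y⁻¹ ∈ M ∧ x ⋆ y ∈ M

lemma ContainsDerived.isSubalgebra {K M : Subgroup G} (h : ContainsDerived K M) (hMK : M ≤ K) :
    IsSubalgebra M := fun x hx y hy => (h x (hMK hx) y (hMK hy)).2

lemma maximal_containsDerived {K M : Subgroup G} (hKs : IsSubalgebra K)
    (hnil : ∃ n : ℕ, ∀ k ∈ K, k ∈ upperCentralIn K n)
    (hM : IsMaximalSubalgebraIn K M) : ContainsDerived K M := by
  classical
  obtain ⟨hMs, hMK, hmax⟩ := hM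
  have hex : ∃ n, ¬ upperCentralIn K n ⊆ (M : Set G) := by
    obtain ⟨n, hn⟩ := hnil
    refine ⟨n, fun h => ?_⟩
    exact hMK.not_ge (fun k hk => h (hn k hk))
  obtain ⟨z, hzK, hzM, hz⟩ : ∃ z ∈ K, z ∉ M ∧
      ∀ x ∈ K, z * x * z⁻¹ * x⁻¹ ∈ M ∧ z ⋆ x ∈ M := by
    have h1 := Nat.find_spec hex
    have h2 := fun m => Nat.find_min hex (m := m)
    generalize Nat.find hex = i at h1 h2
    cases i with
    | zero =>
      exfalso; apply h1
      intro x hx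
      have : x = 1 := hx
      rw [this]; exact M.one_mem
    | succ j =>
      have h3 : upperCentralIn K j ⊆ (M : Set G) := not_not.1 (h2 j (Nat.lt_succ_self j))
      obtain ⟨z, hz, hzM⟩ := Set.not_subset.1 h1
      obtain ⟨hzK, hz'⟩ := hz
      exact ⟨z, hzK, hzM, fun x hx => ⟨h3 (hz' x hx).1, h3 (hz' x hx).2⟩⟩
  have hTK : M ⊔ Subgroup.zpowers z ≤ K :=
    sup_le hMK.le (by rwa [Subgroup.zpowers_le])
  have hnorm : M ⊔ Subgroup.zpowers z ≤ Subgroup.normalizer (M : Set G) := by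
    refine sup_le Subgroup.le_normalizer ?_
    rw [Subgroup.zpowers_le, Subgroup.mem_normalizer_iff]
    intro m
    constructor
    · intro hm
      have := M.mul_mem (hz m (hMK.le hm)).1 hm
      simpa using this
    · intro hm
      have hmK : m ∈ K := by
        have := K.mul_mem (K.mul_mem (K.inv_mem hzK) (hMK.le hm)) hzK
        simpa [mul_assoc] using this
      have := M.mul_mem (M.inv_mem (hz m hmK).1) hm
      simpa [mul_assoc] using this
  have s1 := aux_bider (fun x y : G => x ⋆ y) star_mul_left star_anti M z hnorm
    (fun x hx => (hz x (hTK hx)).2) hMs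
  have s2 := aux_bider (fun x y : G => x * y * x⁻¹ * y⁻¹) (by intros; group) (by intros; group)
    M z hnorm (fun x hx => (hz x (hTK hx)).1)
    (fun x hx y hy => M.mul_mem (M.mul_mem (M.mul_mem hx hy) (M.inv_mem hx)) (M.inv_mem hy))
  have hlt : M < M ⊔ Subgroup.zpowers z := by
    refine lt_of_le_of_ne le_sup_left (fun h => hzM ?_)
    rw [h]
    exact (le_sup_right : _ ≤ M ⊔ Subgroup.zpowers z) (Subgroup.mem_zpowers z)
  have hE := hmax _ (fun x hx y hy => (le_sup_left : M ≤ _) (s1 x hx y hy)) hTK hlt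
  rw [hE] at s1 s2
  exact fun x hx y hy => ⟨s2 x hx y hy, s1 x hx y hy⟩

lemma aux_invariant {K M : Subgroup G} (hM : IsMaximalSubalgebraIn K M)
    (hP : ContainsDerived K M) (u : G → G) (huK : ∀ k ∈ K, u k ∈ K)
    (hmul : ∀ h ∈ K, ∀ k ∈ K, (u h * u k)⁻¹ * u (h * k) ∈ M)
    (hstar : ∀ h ∈ K, ∀ k ∈ K, u (h ⋆ k) ∈ M) (hKs : IsSubalgebra K)
    {x : G} (hx : x ∈ frattiniIn K) : u x ∈ M := by
  have hMK := hM.2.1.le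
  haveI hn : (M.subgroupOf K).Normal := by
    refine ⟨fun m hm g => ?_⟩
    rw [Subgroup.mem_subgroupOf] at hm ⊢
    have := M.mul_mem (hP g g.2 m m.2).1 hm
    simpa using this
  have hcomm : ∀ a b : K ⧸ M.subgroupOf K, a * b = b * a := by
    intro a b
    obtain ⟨a, rfl⟩ := QuotientGroup.mk_surjective a
    obtain ⟨b, rfl⟩ := QuotientGroup.mk_surjective b
    rw [← QuotientGroup.mk_mul, ← QuotientGroup.mk_mul, QuotientGroup.eq,
      Subgroup.mem_subgroupOf]
    have := (hP _ (K.inv_mem b.2) _ (K.inv_mem a.2)).1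
    simpa [mul_assoc] using this
  let f : K →* K ⧸ M.subgroupOf K := MonoidHom.mk'
    (fun k => QuotientGroup.mk (⟨u k, huK k k.2⟩ : K)) (by
      intro a b
      rw [← QuotientGroup.mk_mul, eq_comm, QuotientGroup.eq, Subgroup.mem_subgroupOf]
      exact hmul a a.2 b b.2)
  have hf : ∀ k : K, f k = 1 ↔ u k ∈ M := by
    intro k
    change (QuotientGroup.mk (⟨u k, huK k k.2⟩ : K) : K ⧸ M.subgroupOf K) = 1 ↔ _
    rw [QuotientGroup.eq_one_iff, Subgroup.mem_subgroupOf]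
  let N : Subgroup G := f.ker.map K.subtype
  have hN : ∀ k, k ∈ N ↔ k ∈ K ∧ u k ∈ M := by
    intro k
    constructor
    · rintro ⟨k, hk, rfl⟩
      exact ⟨k.2, (hf k).1 hk⟩
    · rintro ⟨h1, h2⟩
      exact ⟨⟨k, h1⟩, (hf _).2 h2, rfl⟩
  have hNK : N ≤ K := fun k hk => ((hN k).1 hk).1
  have hPN : ContainsDerived K N := by
    intro a ha b hb
    constructor
    · refine ⟨⟨a, ha⟩ * ⟨b, hb⟩ * ⟨a, ha⟩⁻¹ * ⟨b, hb⟩⁻¹, ?_, rfl⟩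
      change f _ = 1
      rw [map_mul, map_mul, map_mul, hcomm (f ⟨a, ha⟩), map_inv, map_inv]
      group
    · exact (hN _).2 ⟨hKs a ha b hb, hstar a ha b hb⟩
  have hxK : x ∈ K := hx.1
  by_cases hE : N = K
  · exact ((hN x).1 (hE ▸ hxK)).2
  have hNmax : IsMaximalSubalgebraIn K N := by
    refine ⟨hPN.isSubalgebra hNK, lt_of_le_of_ne hNK hE, fun N' _ hN'K hlt => ?_⟩
    obtain ⟨n, hnN', hnN⟩ := SetLike.exists_of_lt hlt
    have hnK := hN'K hnN'
    have hunM : u n ∉ M := fun h => hnN ((hN n).2 ⟨hnK, h⟩)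
    let L : Subgroup G :=
      ((Subgroup.zpowers (f ⟨n, hnK⟩)).comap (QuotientGroup.mk' (M.subgroupOf K))).map K.subtype
    have hLK : L ≤ K := by
      rintro _ ⟨k, _, rfl⟩; exact k.2
    have hML : M ≤ L := by
      intro m hm
      refine ⟨⟨m, hMK hm⟩, ?_, rfl⟩
      change (QuotientGroup.mk (⟨m, hMK hm⟩ : K) : K ⧸ M.subgroupOf K) ∈
        Subgroup.zpowers (f ⟨n, hnK⟩)
      rw [(QuotientGroup.eq_one_iff _).2 (Subgroup.mem_subgroupOf.2 hm)]
      exact Subgroup.one_mem _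
    have huL : u n ∈ L :=
      ⟨⟨u n, huK n hnK⟩, Subgroup.mem_zpowers (f ⟨n, hnK⟩), rfl⟩
    have hLE : L = K := hM.2.2 L
      (fun a ha b hb => hML (hP a (hLK ha) b (hLK hb)).2) hLK
      (lt_of_le_of_ne hML (fun h => hunM (h ▸ huL)))
    refine le_antisymm hN'K (fun k hk => ?_)
    have huk : u k ∈ L := hLE ▸ huK k hk
    obtain ⟨w, hw, hwk⟩ := huk
    have hw' : w = ⟨u k, huK k hk⟩ := Subtype.ext hwk
    subst hw'
    obtain ⟨i, hi⟩ := Subgroup.mem_zpowers_iff.1 (show f ⟨k, hk⟩ ∈ Subgroup.zpowers _ from hw)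
    have h1 : k * (n ^ i)⁻¹ ∈ N := by
      refine ⟨⟨k, hk⟩ * (⟨n, hnK⟩ ^ i)⁻¹, ?_, by simp⟩
      change f _ = 1
      rw [map_mul, map_inv, map_zpow, hi, mul_inv_cancel]
    have := N'.mul_mem (hlt.le h1) (N'.zpow_mem hnN' i)
    simpa using this
  have hxN : x ∈ N := (Subgroup.mem_sInf.1 hx.2) N hNmax
  exact ((hN x).1 hxN).2

lemma frattiniIn_isIdeal {K : Subgroup G} (hK : IsIdeal K)
    (hnil : ∃ n : ℕ, ∀ k ∈ K, k ∈ upperCentralIn K n) : IsIdeal (frattiniIn K) := by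
  have hKn := hK.1
  have hKs : IsSubalgebra K := fun x _ y hy => hK.2 x y hy
  constructor
  · refine ⟨fun x hx g => ⟨hKn.conj_mem _ hx.1 g, Subgroup.mem_sInf.2 fun M hM => ?_⟩⟩
    have hP := maximal_containsDerived hKs hnil hM
    refine aux_invariant hM hP (fun k => g * k * g⁻¹) (fun k hk => hKn.conj_mem _ hk g) ?_ ?_ hKs hx
    · intro h _ k _
      convert M.one_mem using 1
      group
    · intro h hh k hk
      change g * (h ⋆ k) * g⁻¹ ∈ M
      rw [conj_star]
      exact (hP _ (hKn.conj_mem _ hh g) _ (hKn.conj_mem _ hk g)).2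
  · refine fun g x hx => ⟨hK.2 g x hx.1, Subgroup.mem_sInf.2 fun M hM => ?_⟩
    have hP := maximal_containsDerived hKs hnil hM
    have hKr : ∀ k ∈ K, ∀ g, k ⋆ g ∈ K := fun k hk g => by
      rw [star_anti g k]; exact K.inv_mem (hK.2 g k hk)
    refine aux_invariant hM hP (fun k => g ⋆ k) (fun k hk => hK.2 g k hk) ?_ ?_ hKs hx
    · intro h hh k hk
      change (g ⋆ h * g ⋆ k)⁻¹ * g ⋆ (h * k) ∈ M
      rw [star_mul_right]
      have := (hP _ (K.inv_mem (hK.2 g k hk)) h hh).1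
      convert this using 1
      group
    · intro a ha b hb
      change g ⋆ (a ⋆ b) ∈ M
      rw [star_anti (a ⋆ b) g]
      apply M.inv_mem
      have hj := star_jacobi (b⁻¹ * g * b) a b
      have e : b * (b⁻¹ * g * b) * b⁻¹ = g := by group
      rw [e] at hj
      set g' := b⁻¹ * g * b
      have h1 := (hP (g' ⋆ a) (hK.2 _ _ ha) (a * b * a⁻¹) (hKn.conj_mem _ hb a)).2
      have h2 := (hP (b ⋆ g') (hKr b hb g') (g' * a * g'⁻¹) (hKn.conj_mem _ ha g')).2
      have : (a ⋆ b) ⋆ g = ((g' ⋆ a) ⋆ (a * b * a⁻¹))⁻¹ * ((b ⋆ g') ⋆ (g' * a * g'⁻¹))⁻¹ := by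
        rw [eq_mul_inv_iff_mul_eq]
        rw [mul_assoc] at hj
        exact eq_inv_of_mul_eq_one_right hj
      rw [this]
      exact M.mul_mem (M.inv_mem h1) (M.inv_mem h2)

lemma sup_isSubalgebra {M I : Subgroup G} (hM : IsSubalgebra M) (hI : IsIdeal I) :
    IsSubalgebra (M ⊔ I) := by
  haveI := hI.1
  have hr : ∀ k ∈ I, ∀ g, k ⋆ g ∈ I := fun k hk g => by
    rw [star_anti g k]; exact I.inv_mem (hI.2 g k hk)
  intro x hx y hy
  obtain ⟨m, hm, i, hi, rfl⟩ := Subgroup.mem_sup_of_normal_right.1 hx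
  obtain ⟨m', hm', j, hj, rfl⟩ := Subgroup.mem_sup_of_normal_right.1 hy
  have l1 : M ≤ M ⊔ I := le_sup_left
  have l2 : I ≤ M ⊔ I := le_sup_right
  rw [star_mul_left, star_mul_right m]
  exact mul_mem (l2 (hI.1.conj_mem _ (hr i hi _) m))
    (mul_mem (l1 (hM m hm m' hm')) (l2 (hI.1.conj_mem _ (hI.2 _ _ hj) m')))

lemma exists_maximalIn [Finite G] {K H : Subgroup G} (hH : IsSubalgebra H) (hHK : H < K) :
    ∃ L, IsMaximalSubalgebraIn K L ∧ H ≤ L := by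
  obtain ⟨L, hHL, hL⟩ := (Set.toFinite {L : Subgroup G | IsSubalgebra L ∧ L < K}).exists_le_maximal
    (show H ∈ _ from ⟨hH, hHK⟩)
  refine ⟨L, ⟨hL.prop.1, hL.prop.2, fun N hN hNK hlt => ?_⟩, hHL⟩
  by_contra hne
  exact hlt.not_ge (hL.le_of_ge ⟨hN, lt_of_le_of_ne hNK hne⟩ hlt.le)

end helpers

/-- if `G` is a finite multiplicative Lie algebra and `K` a
nilpotent ideal of `G`, then `Φ̃(K) ⊆ Φ̃(G)`. -/
theorem frattiniIn_le_frattini_of_nilpotent_ideal {G : Type*} [MulLieAlgebra G] [Finite G]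
    (K : Subgroup G) (hK : IsIdeal K)
    (hnil : ∃ n : ℕ, ∀ k ∈ K, k ∈ upperCentralIn K n) :
    frattiniIn K ≤ frattini G := by
  have hI := frattiniIn_isIdeal hK hnil
  have hKs : IsSubalgebra K := fun x _ y hy => hK.2 x y hy
  haveI := hI.1
  refine le_sInf fun M hM => ?_
  by_contra hle
  have htop : M ⊔ frattiniIn K = ⊤ := hM.2.2 _ (sup_isSubalgebra hM.1 hI)
    (left_lt_sup.2 hle)
  have hKM : ¬ K ≤ M := fun h => hle (inf_le_left.trans h)
  have hlt : K ⊓ M < K := lt_of_le_of_ne inf_le_left (fun h => hKM (inf_eq_left.1 h))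
  obtain ⟨L, hL, hKL⟩ := exists_maximalIn (H := K ⊓ M)
    (fun x hx y hy => ⟨hKs x hx.1 y hy.1, hM.1 x hx.2 y hy.2⟩) hlt
  have hFL : frattiniIn K ≤ L := inf_le_right.trans (sInf_le hL)
  refine hL.2.1.not_ge (fun k hk => ?_)
  have hk' : k ∈ M ⊔ frattiniIn K := htop ▸ Subgroup.mem_top k
  obtain ⟨m, hm, i, hi, rfl⟩ := Subgroup.mem_sup_of_normal_right.1 hk'
  have hmK : m ∈ K := by
    have := K.mul_mem hk (K.inv_mem hi.1)
    simpa using this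
  exact L.mul_mem (hKL ⟨hmK, hm⟩) (hFL hi)

end MulLieAlgebra
end

section
/- Let G be a multiplicative Lie algebra with G ≠ {1} whose only subalgebras are {1} and G. Then the underlying group of G is cyclic of prime order. -/
namespace MulLieAlgebra

local infixl:72 " ⋆ " => MulLieAlgebra.star

variable {G : Type*} [MulLieAlgebra G]

end MulLieAlgebra

namespace MulLieAlgebra

/-- The right annihilator of an element, as a subgroup. -/
def rightAnn {G : Type*} [MulLieAlgebra G] (g : G) : Subgroup G where
  carrier := {x | star g x = 1}
  one_mem' := by
    have := star_mul_right g 1 1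
    simpa using this
  mul_mem' := by
    intro a b ha hb
    have ha' : star g a = 1 := ha
    have hb' : star g b = 1 := hb
    change star g (a * b) = 1
    rw [star_mul_right, ha', hb']
    simp
  inv_mem' := by
    intro a ha
    have ha' : star g a = 1 := ha
    change star g a⁻¹ = 1
    have h1 : star g (1 : G) = 1 := by
      have := star_mul_right g 1 1
      simpa using this
    have := star_mul_right g a a⁻¹
    rw [mul_inv_cancel, h1, ha', one_mul] at this
    exact conj_eq_one_iff.mp this.symm

/-- The left annihilator of an element, as a subgroup. -/
def leftAnn {G : Type*} [MulLieAlgebra G] (g : G) : Subgroup G where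
  carrier := {x | star x g = 1}
  one_mem' := by
    have := star_mul_left 1 1 g
    simpa using this
  mul_mem' := by
    intro a b ha hb
    have ha' : star a g = 1 := ha
    have hb' : star b g = 1 := hb
    change star (a * b) g = 1
    rw [star_mul_left, ha', hb']
    simp
  inv_mem' := by
    intro a ha
    have ha' : star a g = 1 := ha
    change star a⁻¹ g = 1
    have h1 : star (1 : G) g = 1 := by
      have := star_mul_left 1 1 g
      simpa using this
    have := star_mul_left a a⁻¹ g
    rw [mul_inv_cancel, h1, ha', mul_one] at this
    exact conj_eq_one_iff.mp this.symm

theorem isSubalgebra_zpowers {G : Type*} [MulLieAlgebra G] (g : G) :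
    IsSubalgebra (Subgroup.zpowers g) := by
  intro x hx y hy
  have h1 : Subgroup.zpowers g ≤ rightAnn g :=
    Subgroup.zpowers_le.mpr (star_self g)
  have h2 : Subgroup.zpowers g ≤ leftAnn y :=
    Subgroup.zpowers_le.mpr (h1 hy)
  have h3 : star x y = 1 := h2 hx
  rw [h3]
  exact Subgroup.one_mem _

/-- a nontrivial multiplicative Lie algebra whose only
subalgebras are `{1}` and `G` has underlying group cyclic of prime order. -/
theorem cyclic_prime_of_no_proper_subalgebra (G : Type*) [MulLieAlgebra G]
    [Nontrivial G]
    (h : ∀ H : Subgroup G, IsSubalgebra H → H = ⊥ ∨ H = ⊤) :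
    IsCyclic G ∧ (Nat.card G).Prime := by
  have key : ∀ g : G, g ≠ 1 → Subgroup.zpowers g = ⊤ := fun g hg =>
    (h _ (isSubalgebra_zpowers g)).resolve_left
      (fun hb => hg (Subgroup.zpowers_eq_bot.mp hb))
  obtain ⟨g, hg⟩ := exists_ne (1 : G)
  have hc : IsCyclic G := isCyclic_iff_exists_zpowers_eq_top.mpr ⟨g, key g hg⟩
  refine ⟨hc, ?_⟩
  have hs : IsSimpleGroup G := ⟨fun H _ => by
    rcases H.bot_or_exists_ne_one with hb | ⟨x, hx, hx1⟩
    · exact Or.inl hb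
    · right
      rw [eq_top_iff, ← key x hx1]
      exact Subgroup.zpowers_le.mpr hx⟩
  letI : CommGroup G := IsCyclic.commGroup
  exact IsSimpleGroup.prime_card

end MulLieAlgebra
end

section
/- Let τ₁ : L₁ → G₁ and τ₂ : L₂ → G₂ be relative Lie central extensions of the pairs (H₁,G₁) and (H₂,G₂) of multiplicative Lie algebras, and let (θ,β) be an isoclinism from τ₁ to τ₂. Then θ(τ₁(x)) = τ₂(β(x)) for all x ∈ ^M{G₁,L₁}. -/
namespace MulLieAlgebra

local infixl:72 " ⋆ " => MulLieAlgebra.star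

variable {G : Type*} [MulLieAlgebra G]

end MulLieAlgebra

namespace MulLieAlgebra

local infixl:72 " ⋆ " => MulLieAlgebra.star

/-- A relative Lie central extension `τ : L → G` of the pair `(H, G)`:
a multiplicative Lie algebra homomorphism `τ` together with compatible
actions of `G` and `L` on each other (group actions `act : G → L → L`,
`act' : L → G → G` and brackets `br : G → L → L`, `br' : L → G → G`),
with `τ(L) = H`, `G` acting trivially on `ker τ`, and the remaining
defining identities of a relative Lie central extension. -/
structure RelativeLieCentralExtension (L G : Type*) [MulLieAlgebra L] [MulLieAlgebra G]
    (H : Subgroup G) where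
  /-- the underlying group homomorphism `τ : L → G` -/
  τ : L →* G
  /-- `τ` preserves the Lie product -/
  map_star : ∀ l l' : L, τ (l ⋆ l') = (τ l ⋆ τ l')
  /-- group action of `G` on `L`, `(g, l) ↦ ᵍl` -/
  act : G → L → L
  /-- group action of `L` on `G`, `(l, g) ↦ ˡg` -/
  act' : L → G → G
  /-- bracket `⟨-,-⟩ : G × L → L` -/
  br : G → L → L
  /-- bracket `⟨-,-⟩ : L × G → G` -/
  br' : L → G → G
  act_one : ∀ l : L, act 1 l = l
  act_mul : ∀ (g g' : G) (l : L), act (g * g') l = act g (act g' l)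
  act'_one : ∀ g : G, act' (1 : L) g = g
  act'_mul : ∀ (l l' : L) (g : G), act' (l * l') g = act' l (act' l' g)
  /-- `⟨g, ll'⟩ = ⟨g,l⟩·⟨ˡg, ˡl'⟩` -/
  br_mul_right : ∀ (g : G) (l l' : L),
    br g (l * l') = br g l * br (act' l g) (l * l' * l⁻¹)
  /-- `⟨gg', l⟩ = ⟨ᵍg', ᵍl⟩·⟨g,l⟩` -/
  br_mul_left : ∀ (g g' : G) (l : L),
    br (g * g') l = br (g * g' * g⁻¹) (act g l) * br g l
  /-- `⟨g⋆g', ^{g'}l⟩·⟨ˡg, ⟨g',l⟩⟩⁻¹·⟨ᵍg', ⟨g,l⟩⁻¹⟩⁻¹ = 1` -/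
  br_star : ∀ (g g' : G) (l : L),
    br (g ⋆ g') (act g' l) * (br (act' l g) (br g' l))⁻¹ *
      (br (g * g' * g⁻¹) ((br g l)⁻¹))⁻¹ = 1
  /-- `⟨^{l'}g, l⋆l'⟩·(ˡl'⋆⟨g,l⟩)·(ᵍl⋆⟨g,l'⟩⁻¹) = 1` -/
  br_star' : ∀ (g : G) (l l' : L),
    br (act' l' g) (l ⋆ l') * ((l * l' * l⁻¹) ⋆ br g l) * (act g l ⋆ (br g l')⁻¹) = 1
  /-- `⟨l, gg'⟩ = ⟨l,g⟩·⟨ᵍl, ᵍg'⟩` -/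
  br'_mul_right : ∀ (l : L) (g g' : G),
    br' l (g * g') = br' l g * br' (act g l) (g * g' * g⁻¹)
  /-- `⟨ll', g⟩ = ⟨ˡl', ˡg⟩·⟨l,g⟩` -/
  br'_mul_left : ∀ (l l' : L) (g : G),
    br' (l * l') g = br' (l * l' * l⁻¹) (act' l g) * br' l g
  /-- `⟨l⋆l', ^{l'}g⟩·⟨ᵍl, ⟨l',g⟩⟩⁻¹·⟨ˡl', ⟨l,g⟩⁻¹⟩⁻¹ = 1` -/
  br'_star : ∀ (l l' : L) (g : G),
    br' (l ⋆ l') (act' l' g) * (br' (act g l) (br' l' g))⁻¹ *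
      (br' (l * l' * l⁻¹) ((br' l g)⁻¹))⁻¹ = 1
  /-- `⟨^{g'}l, g⋆g'⟩·(ᵍg'⋆⟨l,g⟩)·(ˡg⋆⟨l,g'⟩⁻¹) = 1` -/
  br'_star' : ∀ (l : L) (g g' : G),
    br' (act g' l) (g ⋆ g') * ((g * g' * g⁻¹) ⋆ br' l g) * (act' l g ⋆ (br' l g')⁻¹) = 1
  /-- compatibility: `^{(ᵍl)}g' = ᵍ(ˡ(^{g⁻¹}g'))` -/
  compat_act : ∀ (g : G) (l : L) (g' : G),
    act' (act g l) g' = g * act' l (g⁻¹ * g' * g) * g⁻¹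
  /-- compatibility: `^{(ˡg)}l' = ˡ(ᵍ(^{l⁻¹}l'))` -/
  compat_act' : ∀ (l : L) (g : G) (l' : L),
    act (act' l g) l' = l * act g (l⁻¹ * l' * l) * l⁻¹
  /-- compatibility: `⟨⟨l,g⟩⁻¹, l'⟩ = ⟨g,l⟩⋆l'` -/
  compat_br : ∀ (l : L) (g : G) (l' : L), br (br' l g)⁻¹ l' = (br g l ⋆ l')
  /-- compatibility: `⟨⟨g,l⟩⁻¹, g'⟩ = ⟨l,g⟩⋆g'` -/
  compat_br' : ∀ (g : G) (l : L) (g' : G), br' ((br g l)⁻¹) g' = (br' l g ⋆ g')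
  /-- compatibility: `^{⟨g,l⟩·⟨l,g⟩}l' = l'` -/
  compat_triv : ∀ (g : G) (l l' : L),
    br g l * act (br' l g) l' * (br g l)⁻¹ = l'
  /-- compatibility: `^{⟨g,l⟩·⟨l,g⟩}g' = g'` -/
  compat_triv' : ∀ (g : G) (l : L) (g' : G),
    act' (br g l) (br' l g * g' * (br' l g)⁻¹) = g'
  /-- compatibility: `ᵍ⟨l,g'⟩ = ⟨ᵍl, ᵍg'⟩` -/
  compat_conj : ∀ (g : G) (l : L) (g' : G),
    g * br' l g' * g⁻¹ = br' (act g l) (g * g' * g⁻¹)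
  /-- compatibility: `ˡ⟨g,l'⟩ = ⟨ˡg, ˡl'⟩` -/
  compat_conj' : ∀ (l : L) (g : G) (l' : L),
    l * br g l' * l⁻¹ = br (act' l g) (l * l' * l⁻¹)
  /-- compatibility: `⟨g·ˡ(g⁻¹), l'⟩ = (ᵍl·l⁻¹)⋆l'` -/
  compat_star : ∀ (g : G) (l l' : L),
    br (g * act' l g⁻¹) l' = ((act g l * l⁻¹) ⋆ l')
  /-- compatibility: `⟨l·ᵍ(l⁻¹), g'⟩ = (ˡg·g⁻¹)⋆g'` -/
  compat_star' : ∀ (l : L) (g g' : G),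
    br' (l * act g l⁻¹) g' = ((act' l g * g⁻¹) ⋆ g')
  /-- `τ(L) = H` -/
  range_eq : ∀ g : G, g ∈ H ↔ ∃ l : L, τ l = g
  /-- `G` acts trivially on `ker τ` (action part) -/
  act_ker : ∀ (g : G) (l : L), τ l = 1 → act g l = l
  /-- `G` acts trivially on `ker τ` (bracket part) -/
  br_ker : ∀ (g : G) (l : L), τ l = 1 → br g l = 1
  /-- `τ(ᵍl) = g·τ(l)·g⁻¹` -/
  τ_act : ∀ (g : G) (l : L), τ (act g l) = g * τ l * g⁻¹
  /-- `τ(⟨g,l⟩) = g ⋆ τ(l)` -/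
  τ_br : ∀ (g : G) (l : L), τ (br g l) = (g ⋆ τ l)
  /-- `^{τ(l)}l' = l·l'·l⁻¹` -/
  act_τ : ∀ l l' : L, act (τ l) l' = l * l' * l⁻¹
  /-- `⟨τ(l), l'⟩ = l ⋆ l'` -/
  br_τ : ∀ l l' : L, br (τ l) l' = (l ⋆ l')
  /-- `ˡg = ^{τ(l)}g` -/
  act'_τ : ∀ (l : L) (g : G), act' l g = τ l * g * (τ l)⁻¹
  /-- `⟨l,g⟩ = τ(l) ⋆ g` -/
  br'_τ : ∀ (l : L) (g : G), br' l g = (τ l ⋆ g)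

/-- The `G`-Lie commutator `^M{G,L}` of a relative Lie central extension:
the subgroup of `L` generated by all `ᵍl·l⁻¹·⟨g',l'⟩`. -/
def MGLCommutator {L G : Type*} [MulLieAlgebra L] [MulLieAlgebra G] {H : Subgroup G}
    (E : RelativeLieCentralExtension L G H) : Subgroup L :=
  Subgroup.closure
    {x : L | ∃ (g g' : G) (l l' : L), x = E.act g l * l⁻¹ * E.br g' l'}

end MulLieAlgebra

namespace MulLieAlgebra

local infixl:72 " ⋆ " => MulLieAlgebra.star

/-- if `(θ, β)` is an isoclinism between the relative Lie central
extensions `τ₁ : L₁ → G₁` and `τ₂ : L₂ → G₂` of the pairs `(H₁,G₁)` and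
`(H₂,G₂)`, then `θ(τ₁(x)) = τ₂(β(x))` for every `x ∈ ^M{G₁,L₁}`. -/
theorem isoclinism_commutes_with_τ
    {L₁ G₁ L₂ G₂ : Type*} [MulLieAlgebra L₁] [MulLieAlgebra G₁]
    [MulLieAlgebra L₂] [MulLieAlgebra G₂]
    (H₁ : Subgroup G₁) (H₂ : Subgroup G₂) (hH₁ : IsIdeal H₁) (hH₂ : IsIdeal H₂)
    (E₁ : RelativeLieCentralExtension L₁ G₁ H₁)
    (E₂ : RelativeLieCentralExtension L₂ G₂ H₂)
    -- the isomorphism θ : G₁ → G₂ of multiplicative Lie algebras, with θ(H₁) = H₂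
    (θ : G₁ ≃* G₂) (θ_star : ∀ a b : G₁, θ (a ⋆ b) = (θ a ⋆ θ b))
    (θ_H : ∀ g : G₁, g ∈ H₁ ↔ θ g ∈ H₂)
    -- the isomorphism β : ^M{G₁,L₁} → ^M{G₂,L₂}, preserving the Lie product
    (β : ↥(MGLCommutator E₁) ≃* ↥(MGLCommutator E₂))
    (β_star : ∀ (x y : ↥(MGLCommutator E₁))
      (h : ((x : L₁) ⋆ (y : L₁)) ∈ MGLCommutator E₁),
      ((β ⟨((x : L₁) ⋆ (y : L₁)), h⟩ : ↥(MGLCommutator E₂)) : L₂)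
        = ((β x : L₂) ⋆ (β y : L₂)))
    -- the isoclinism conditions on β
    (hβ_act : ∀ (g₁ : G₁) (l₁ : L₁) (l₂ : L₂)
      (h₁ : E₁.act g₁ l₁ * l₁⁻¹ ∈ MGLCommutator E₁),
      θ (E₁.τ l₁) = E₂.τ l₂ →
        ((β ⟨E₁.act g₁ l₁ * l₁⁻¹, h₁⟩ : ↥(MGLCommutator E₂)) : L₂)
          = E₂.act (θ g₁) l₂ * l₂⁻¹)
    (hβ_br : ∀ (g₁ : G₁) (l₁ : L₁) (l₂ : L₂)
      (h₁ : E₁.br g₁ l₁ ∈ MGLCommutator E₁),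
      θ (E₁.τ l₁) = E₂.τ l₂ →
        ((β ⟨E₁.br g₁ l₁, h₁⟩ : ↥(MGLCommutator E₂)) : L₂) = E₂.br (θ g₁) l₂) :
    ∀ x : ↥(MGLCommutator E₁), θ (E₁.τ (x : L₁)) = E₂.τ ((β x : L₂)) := by
  have act_mem : ∀ (g : G₁) (l : L₁), E₁.act g l * l⁻¹ ∈ MGLCommutator E₁ := by
    intro g l
    refine Subgroup.subset_closure ⟨g, 1, l, 1, ?_⟩
    rw [E₁.br_ker 1 1 (map_one _), mul_one]
  have br_mem : ∀ (g : G₁) (l : L₁), E₁.br g l ∈ MGLCommutator E₁ := by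
    intro g l
    refine Subgroup.subset_closure ⟨1, g, 1, l, ?_⟩
    rw [E₁.act_one, mul_inv_cancel, one_mul]
  have lift : ∀ l : L₁, ∃ l₂ : L₂, θ (E₁.τ l) = E₂.τ l₂ := by
    intro l
    obtain ⟨l₂, h⟩ := (E₂.range_eq _).1 ((θ_H _).1 ((E₁.range_eq _).2 ⟨l, rfl⟩))
    exact ⟨l₂, h.symm⟩
  let f : ↥(MGLCommutator E₁) →* G₂ :=
    (θ.toMonoidHom.comp E₁.τ).comp (MGLCommutator E₁).subtype
  let k : ↥(MGLCommutator E₁) →* G₂ :=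
    (E₂.τ.comp (MGLCommutator E₂).subtype).comp β.toMonoidHom
  have hact : ∀ (g : G₁) (l : L₁), f ⟨_, act_mem g l⟩ = k ⟨_, act_mem g l⟩ := by
    intro g l
    obtain ⟨l₂, h⟩ := lift l
    change θ (E₁.τ (E₁.act g l * l⁻¹)) = E₂.τ (β ⟨_, act_mem g l⟩ : L₂)
    rw [hβ_act g l l₂ _ h]
    simp only [map_mul, map_inv, E₁.τ_act, E₂.τ_act, h]
  have hbr : ∀ (g : G₁) (l : L₁), f ⟨_, br_mem g l⟩ = k ⟨_, br_mem g l⟩ := by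
    intro g l
    obtain ⟨l₂, h⟩ := lift l
    change θ (E₁.τ (E₁.br g l)) = E₂.τ (β ⟨_, br_mem g l⟩ : L₂)
    rw [hβ_br g l l₂ _ h, E₁.τ_br, E₂.τ_br, θ_star, h]
  have key : ∀ (x : L₁) (hx : x ∈ MGLCommutator E₁), f ⟨x, hx⟩ = k ⟨x, hx⟩ := by
    intro x hx
    refine Subgroup.closure_induction
      (p := fun x hx => f ⟨x, hx⟩ = k ⟨x, hx⟩) ?_ ?_ ?_ ?_ hx
    · rintro x ⟨g, g', l, l', rfl⟩
      have := congrArg₂ (· * ·) (hact g l) (hbr g' l')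
      simp only [← map_mul] at this
      exact this
    · exact (map_one f).trans (map_one k).symm
    · intro x y hx hy h1 h2
      have := congrArg₂ (· * ·) h1 h2
      simp only [← map_mul] at this
      exact this
    · intro x hx h
      have := congrArg (·⁻¹) h
      simp only [← map_inv] at this
      exact this
  intro x
  exact key x.1 x.2

end MulLieAlgebra
end

section
/- Let τ₁ : L₁ → G₁ and τ₂ : L₂ → G₂ be relative Lie central extensions of the pairs (H₁,G₁) and (H₂,G₂) of multiplicative Lie algebras, and let (θ,β) be an isoclinism from τ₁ to τ₂. Then β(ker τ₁ ∩ ^M{G₁,L₁}) = ker τ₂ ∩ ^M{G₂,L₂}. -/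
namespace MulLieAlgebra

local infixl:72 " ⋆ " => MulLieAlgebra.star

variable {G : Type*} [MulLieAlgebra G]

end MulLieAlgebra

namespace MulLieAlgebra

local infixl:72 " ⋆ " => MulLieAlgebra.star

end MulLieAlgebra

namespace MulLieAlgebra

local infixl:72 " ⋆ " => MulLieAlgebra.star

/-- if `(θ, β)` is an isoclinism between the relative Lie central
extensions `τ₁ : L₁ → G₁` and `τ₂ : L₂ → G₂` of the pairs `(H₁,G₁)` and
`(H₂,G₂)`, then `β(ker τ₁ ∩ ^M{G₁,L₁}) = ker τ₂ ∩ ^M{G₂,L₂}`. -/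
theorem isoclinism_maps_ker_inter_commutator
    {L₁ G₁ L₂ G₂ : Type*} [MulLieAlgebra L₁] [MulLieAlgebra G₁]
    [MulLieAlgebra L₂] [MulLieAlgebra G₂]
    (H₁ : Subgroup G₁) (H₂ : Subgroup G₂) (hH₁ : IsIdeal H₁) (hH₂ : IsIdeal H₂)
    (E₁ : RelativeLieCentralExtension L₁ G₁ H₁)
    (E₂ : RelativeLieCentralExtension L₂ G₂ H₂)
    -- the isomorphism θ : G₁ → G₂ of multiplicative Lie algebras, with θ(H₁) = H₂
    (θ : G₁ ≃* G₂) (θ_star : ∀ a b : G₁, θ (a ⋆ b) = (θ a ⋆ θ b))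
    (θ_H : ∀ g : G₁, g ∈ H₁ ↔ θ g ∈ H₂)
    -- the isomorphism β : ^M{G₁,L₁} → ^M{G₂,L₂}, preserving the Lie product
    (β : ↥(MGLCommutator E₁) ≃* ↥(MGLCommutator E₂))
    (β_star : ∀ (x y : ↥(MGLCommutator E₁))
      (h : ((x : L₁) ⋆ (y : L₁)) ∈ MGLCommutator E₁),
      ((β ⟨((x : L₁) ⋆ (y : L₁)), h⟩ : ↥(MGLCommutator E₂)) : L₂)
        = ((β x : L₂) ⋆ (β y : L₂)))
    -- the isoclinism conditions on β
    (hβ_act : ∀ (g₁ : G₁) (l₁ : L₁) (l₂ : L₂)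
      (h₁ : E₁.act g₁ l₁ * l₁⁻¹ ∈ MGLCommutator E₁),
      θ (E₁.τ l₁) = E₂.τ l₂ →
        ((β ⟨E₁.act g₁ l₁ * l₁⁻¹, h₁⟩ : ↥(MGLCommutator E₂)) : L₂)
          = E₂.act (θ g₁) l₂ * l₂⁻¹)
    (hβ_br : ∀ (g₁ : G₁) (l₁ : L₁) (l₂ : L₂)
      (h₁ : E₁.br g₁ l₁ ∈ MGLCommutator E₁),
      θ (E₁.τ l₁) = E₂.τ l₂ →
        ((β ⟨E₁.br g₁ l₁, h₁⟩ : ↥(MGLCommutator E₂)) : L₂) = E₂.br (θ g₁) l₂) :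
    ∀ y : ↥(MGLCommutator E₂),
      E₂.τ (y : L₂) = 1 ↔ ∃ x : ↥(MGLCommutator E₁), E₁.τ (x : L₁) = 1 ∧ β x = y := by
  have key : ∀ (x : L₁) (hx : x ∈ MGLCommutator E₁),
      E₂.τ ((β ⟨x, hx⟩ : ↥(MGLCommutator E₂)) : L₂) = θ (E₁.τ x) := by
    have lift : ∀ l : L₁, ∃ l₂ : L₂, θ (E₁.τ l) = E₂.τ l₂ := by
      intro l
      have h1 : E₁.τ l ∈ H₁ := (E₁.range_eq _).2 ⟨l, rfl⟩
      obtain ⟨l₂, h⟩ := (E₂.range_eq _).1 ((θ_H _).1 h1)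
      exact ⟨l₂, h.symm⟩
    intro x hx
    induction hx using Subgroup.closure_induction with
    | mem x hx =>
      obtain ⟨g, g', l, l', rfl⟩ := hx
      have ha : E₁.act g l * l⁻¹ ∈ MGLCommutator E₁ := by
        refine Subgroup.subset_closure ⟨g, 1, l, 1, ?_⟩
        rw [E₁.br_ker 1 1 (map_one _), mul_one]
      have hb : E₁.br g' l' ∈ MGLCommutator E₁ := by
        refine Subgroup.subset_closure ⟨1, g', 1, l', ?_⟩
        rw [E₁.act_one, mul_inv_cancel, one_mul]
      obtain ⟨m, hm⟩ := lift l
      obtain ⟨m', hm'⟩ := lift l'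
      have e : (β ⟨E₁.act g l * l⁻¹ * E₁.br g' l', mul_mem ha hb⟩ : ↥(MGLCommutator E₂))
          = β ⟨_, ha⟩ * β ⟨_, hb⟩ := by
        rw [← map_mul]; rfl
      rw [e, Subgroup.coe_mul, hβ_act g l m ha hm, hβ_br g' l' m' hb hm']
      simp only [map_mul, map_inv, E₁.τ_act, E₂.τ_act, E₁.τ_br, E₂.τ_br, θ_star, hm, hm']
    | one =>
      have e : β ⟨1, one_mem _⟩ = 1 := map_one β
      rw [e]; simp
    | mul x y hx hy ihx ihy =>
      have e : β ⟨x * y, mul_mem hx hy⟩ = β ⟨x, hx⟩ * β ⟨y, hy⟩ := by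
        rw [← map_mul]; rfl
      rw [e, Subgroup.coe_mul, map_mul, ihx, ihy, map_mul, map_mul]
    | inv x hx ih =>
      have e : β ⟨x⁻¹, inv_mem hx⟩ = (β ⟨x, hx⟩)⁻¹ := by
        rw [← map_inv]; rfl
      rw [e, Subgroup.coe_inv, map_inv, ih, map_inv, map_inv]
  intro y
  constructor
  · intro hy
    refine ⟨β.symm y, ?_, β.apply_symm_apply y⟩
    have h := key (β.symm y : L₁) (β.symm y).2
    rw [Subtype.coe_eta, β.apply_symm_apply, hy] at h
    exact (map_eq_one_iff θ θ.injective).1 h.symm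
  · rintro ⟨x, hx, rfl⟩
    have h := key (x : L₁) x.2
    rw [Subtype.coe_eta, hx, map_one] at h
    exact h

end MulLieAlgebra
end

section
/- Let F be a multiplicative Lie algebra and let R ⊆ T ⊆ S be ideals of F. Then the sequence of group homomorphisms 1 → (R ∩ ^M[T,F])/^M[R,F] → (R ∩ ^M[S,F])/^M[R,F] → (T ∩ ^M[S,F])/^M[T,F] → ((T ∩ ^M[S,F])·R)/(^M[T,F]·R) → 1 is exact, where the first map is induced by the inclusion R ∩ ^M[T,F] ⊆ R ∩ ^M[S,F], the second map is induced by the inclusion R ∩ ^M[S,F] ⊆ T ∩ ^M[S,F] followed by reduction modulo ^M[T,F], and the third map is induced by reduction modulo ^M[T,F]·R. -/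
namespace MulLieAlgebra

local infixl:72 " ⋆ " => MulLieAlgebra.star

variable {G : Type*} [MulLieAlgebra G]

end MulLieAlgebra

namespace MulLieAlgebra

local infixl:72 " ⋆ " => MulLieAlgebra.star

/-- For an ideal `X` of `F`, the ideal `^M[X,F]`: the subgroup generated by all
commutators `[x,f]` and Lie products `x ⋆ f` with `x ∈ X`, `f ∈ F`. -/
def mulCommutatorWith {F : Type*} [MulLieAlgebra F] (X : Subgroup F) : Subgroup F :=
  Subgroup.closure
    ({y : F | ∃ x ∈ X, ∃ f : F, y = x * f * x⁻¹ * f⁻¹} ∪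
      {y : F | ∃ x ∈ X, ∃ f : F, y = (x ⋆ f)})

theorem mulCommutatorWith_mono {F : Type*} [MulLieAlgebra F] {X Y : Subgroup F} (h : X ≤ Y) :
    mulCommutatorWith X ≤ mulCommutatorWith Y := by
  apply Subgroup.closure_mono
  rintro y (⟨x, hx, f, rfl⟩ | ⟨x, hx, f, rfl⟩)
  · exact Or.inl ⟨x, h hx, f, rfl⟩
  · exact Or.inr ⟨x, h hx, f, rfl⟩

/-- for ideals `R ⊆ T ⊆ S` of a multiplicative Lie algebra `F`,
the sequence
`1 → (R ∩ ^M[T,F])/^M[R,F] → (R ∩ ^M[S,F])/^M[R,F] → (T ∩ ^M[S,F])/^M[T,F]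
   → ((T ∩ ^M[S,F])·R)/(^M[T,F]·R) → 1`
(maps induced by inclusions and reductions) is exact.  Exactness is expressed
elementwise: (1) the first map is injective (its kernel is trivial); (2) the
kernel of the second map is the image of the first; (3) the kernel of the
third map is the image of the second; (4) the third map is surjective. -/
theorem four_term_exact_sequence {F : Type*} [MulLieAlgebra F]
    (R T S : Subgroup F)
    (hR : IsIdeal R) (hT : IsIdeal T) (hS : IsIdeal S)
    (hRT : R ≤ T) (hTS : T ≤ S) :
    -- (1) injectivity of (R ∩ ^M[T,F])/^M[R,F] → (R ∩ ^M[S,F])/^M[R,F]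
    (∀ a ∈ R ⊓ mulCommutatorWith T, ∀ a' ∈ R ⊓ mulCommutatorWith T,
      a * a'⁻¹ ∈ mulCommutatorWith R → a * a'⁻¹ ∈ mulCommutatorWith R) ∧
    -- (2) exactness at (R ∩ ^M[S,F])/^M[R,F]
    (∀ b ∈ R ⊓ mulCommutatorWith S,
      (b ∈ mulCommutatorWith T ↔
        ∃ a ∈ R ⊓ mulCommutatorWith T, b * a⁻¹ ∈ mulCommutatorWith R)) ∧
    -- (3) exactness at (T ∩ ^M[S,F])/^M[T,F]
    (∀ c ∈ T ⊓ mulCommutatorWith S,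
      ((∃ t ∈ mulCommutatorWith T, ∃ r ∈ R, c = t * r) ↔
        ∃ b ∈ R ⊓ mulCommutatorWith S, c * b⁻¹ ∈ mulCommutatorWith T)) ∧
    -- (4) surjectivity onto ((T ∩ ^M[S,F])·R)/(^M[T,F]·R)
    (∀ d : F, (∃ c ∈ T ⊓ mulCommutatorWith S, ∃ r ∈ R, d = c * r) →
      ∃ c ∈ T ⊓ mulCommutatorWith S,
        ∃ t ∈ mulCommutatorWith T, ∃ r ∈ R, d * c⁻¹ = t * r) := by
  have hm1 := mulCommutatorWith_mono hRT
  have hm2 := mulCommutatorWith_mono hTS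
  refine ⟨fun _ _ _ _ h => h, ?_, ?_, ?_⟩
  · rintro b ⟨hbR, -⟩
    constructor
    · intro hb
      exact ⟨b, ⟨hbR, hb⟩, by simp [one_mem]⟩
    · rintro ⟨a, ⟨-, ha⟩, hab⟩
      simpa using mul_mem (hm1 hab) ha
  · rintro c ⟨-, hcS⟩
    constructor
    · rintro ⟨t, ht, r, hr, rfl⟩
      refine ⟨r, ⟨hr, ?_⟩, by simpa using ht⟩
      have h := mul_mem (inv_mem (hm2 ht)) hcS
      simpa using h
    · rintro ⟨b, ⟨hb, -⟩, h⟩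
      exact ⟨c * b⁻¹, h, b, hb, by simp⟩
  · rintro d ⟨c, hc, r, hr, rfl⟩
    exact ⟨c, hc, 1, one_mem _, c * r * c⁻¹, hR.1.conj_mem r hr c, by simp⟩

end MulLieAlgebra
end

section
/- Let (H,G) be a Lie perfect pair of multiplicative Lie algebras, i.e. ^M[G,H] = H, and let τ : L → G be a relative Lie central extension of (H,G) with ker τ ⊆ ^M{G,L} (as holds for any multiplicative covering pair). Then ^M{G,L} = L. -/
namespace MulLieAlgebra

local infixl:72 " ⋆ " => MulLieAlgebra.star

variable {G : Type*} [MulLieAlgebra G]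

end MulLieAlgebra

namespace MulLieAlgebra

local infixl:72 " ⋆ " => MulLieAlgebra.star

end MulLieAlgebra

namespace MulLieAlgebra

local infixl:72 " ⋆ " => MulLieAlgebra.star

/-- The Lie commutator `^M[G,H]` of a pair `(H,G)`: the subgroup generated by
all `[g,h]` and `g' ⋆ h'` with `g, g' ∈ G`, `h, h' ∈ H`. -/
def pairCommutator (G : Type*) [MulLieAlgebra G] (H : Subgroup G) : Subgroup G :=
  Subgroup.closure
    ({x : G | ∃ g : G, ∃ h ∈ H, x = g * h * g⁻¹ * h⁻¹} ∪
      {x : G | ∃ g : G, ∃ h ∈ H, x = (g ⋆ h)})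

/-- if `(H,G)` is a Lie perfect pair (`^M[G,H] = H`) and
`τ : L → G` is a relative Lie central extension of `(H,G)` with
`ker τ ⊆ ^M{G,L}` (as for a multiplicative covering pair), then `^M{G,L} = L`. -/
theorem MGLCommutator_eq_top_of_perfect
    {L G : Type*} [MulLieAlgebra L] [MulLieAlgebra G]
    (H : Subgroup G) (hH : IsIdeal H)
    (hperf : pairCommutator G H = H)
    (E : RelativeLieCentralExtension L G H)
    (hker : ∀ l : L, E.τ l = 1 → l ∈ MGLCommutator E) :
    MGLCommutator E = ⊤ := by
  have key : pairCommutator G H ≤ (MGLCommutator E).map E.τ := by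
    unfold pairCommutator
    rw [Subgroup.closure_le]
    rintro x (⟨g, h, hh, rfl⟩ | ⟨g, h, hh, rfl⟩)
    · obtain ⟨l, rfl⟩ := (E.range_eq h).1 hh
      refine ⟨E.act g l * l⁻¹ * E.br 1 1, Subgroup.subset_closure ⟨g, 1, l, 1, rfl⟩, ?_⟩
      rw [E.br_ker 1 1 (map_one _)]
      simp [E.τ_act]
    · obtain ⟨l, rfl⟩ := (E.range_eq h).1 hh
      refine ⟨E.act 1 1 * 1⁻¹ * E.br g l, Subgroup.subset_closure ⟨1, g, 1, l, rfl⟩, ?_⟩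
      rw [E.act_one]
      simp [E.τ_br]
  rw [eq_top_iff]
  intro l _
  have hl : E.τ l ∈ pairCommutator G H := by
    rw [hperf]
    exact (E.range_eq _).2 ⟨l, rfl⟩
  obtain ⟨m, hm, hml⟩ := key hl
  have h1 : l * m⁻¹ ∈ MGLCommutator E := hker _ (by simp [hml])
  simpa using (MGLCommutator E).mul_mem h1 hm

end MulLieAlgebra
end
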